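/- arXiv:1002.1679 — 4 statements merged into one kernel-verified Lean document; each statement's English description precedes it below -/
import Mathlib

section
/- Let P and Q be integers with P > 0, |Q| = 1, (P,Q) ≠ (3,1), and D = P^2 - 4Q > 0. If u and v are positive integers such that v^2 - D*u^2 = 4 or v^2 - D*u^2 = -4, then there exists a natural number n with u = U_n(P,Q), and there exists a natural number m with v = V_m(P,Q). -/
/-- Lucas sequence of the first kind: `U 0 = 0`, `U 1 = 1`,
`U (n+2) = P * U (n+1) - Q * U n`. -/
def lucasU (P Q : ℤ) : ℕ → ℤ
  | 0 => 0
  | 1 => 1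
  | n + 2 => P * lucasU P Q (n + 1) - Q * lucasU P Q n

/-- Lucas sequence of the second kind: `V 0 = 2`, `V 1 = P`,
`V (n+2) = P * V (n+1) - Q * V n`. -/
def lucasV (P Q : ℤ) : ℕ → ℤ
  | 0 => 2
  | 1 => P
  | n + 2 => P * lucasV P Q (n + 1) - Q * lucasV P Q n

theorem lucasV_succ (P Q : ℤ) (n : ℕ) :
    lucasV P Q (n + 1) = P * lucasU P Q (n + 1) - 2 * Q * lucasU P Q n := by
  induction n using Nat.twoStepInduction with
  | zero => simp [lucasU, lucasV]
  | one => simp [lucasU, lucasV]; ring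
  | more n h₁ h₂ =>
    rw [lucasV, h₁, h₂]
    simp only [lucasU]
    ring

/-- Solutions of `w ^ 2 + P * u * w - u ^ 2 = ±1` are consecutive terms of `lucasU P (-1)`. -/
theorem exists_lucasU_neg_one {P : ℤ} (hP : 0 < P) {u w : ℤ} (hu : 0 < u) (hw : 0 ≤ w)
    (h : w ^ 2 + P * u * w - u ^ 2 = 1 ∨ w ^ 2 + P * u * w - u ^ 2 = -1) :
    ∃ n : ℕ, u = lucasU P (-1) (n + 1) ∧ w = lucasU P (-1) n := by
  induction hk : (u + w).toNat using Nat.strong_induction_on generalizing u w with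
  | _ k ih =>
    obtain rfl | hw := hw.eq_or_lt
    · refine ⟨0, ?_, rfl⟩
      rw [lucasU]
      rcases h with h | h <;> nlinarith
    · have hz : 0 ≤ u - P * w := by
        by_contra! hz
        rcases h with h | h <;> nlinarith
      have hlt : w + (u - P * w) < u + w := by nlinarith
      obtain ⟨n, h₁, h₂⟩ := ih _ (by omega) hw hz
        (h.symm.imp (fun h => by linear_combination -h) (fun h => by linear_combination -h)) rfl
      refine ⟨n + 1, ?_, h₁⟩
      rw [lucasU, ← h₁, ← h₂]
      ring

/-- Solutions of `u ^ 2 - P * u * w + w ^ 2 = ±1` with `w < u` are consecutive terms of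
`lucasU P 1`, unless `P = 3`. -/
theorem exists_lucasU_one {P : ℤ} (hP : P ≠ 3) {u w : ℤ} (hw : 0 ≤ w) (huw : w < u)
    (h : u ^ 2 - P * u * w + w ^ 2 = 1 ∨ u ^ 2 - P * u * w + w ^ 2 = -1) :
    ∃ n : ℕ, u = lucasU P 1 (n + 1) ∧ w = lucasU P 1 n := by
  induction hk : u.toNat using Nat.strong_induction_on generalizing u w with
  | _ k ih =>
    obtain rfl | hw := hw.eq_or_lt
    · refine ⟨0, ?_, rfl⟩
      rw [lucasU]
      rcases h with h | h <;> nlinarith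
    · have hz : 0 ≤ P * w - u := by
        by_contra! hz
        rcases h with h | h <;> nlinarith
      have hzw : P * w - u < w := by
        by_contra! hzw
        have hmul : u * w ≤ u * (P * w - u) := by gcongr; omega
        rcases h with h | h
        · nlinarith
        · have hw₁ : w = 1 := by nlinarith
          subst hw₁
          have hu₂ : u = 2 := by nlinarith
          subst hu₂
          omega
      obtain ⟨n, h₁, h₂⟩ := ih _ (by omega) hz hzw
        (h.imp (fun h => by linear_combination h) (fun h => by linear_combination h)) rfl
      refine ⟨n + 1, ?_, h₁⟩
      rw [lucasU, ← h₁, ← h₂]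
      ring

theorem lucas_recognition (P Q : ℤ) (hP : 0 < P) (hQ : |Q| = 1)
    (hPQ : (P, Q) ≠ (3, 1)) (hD : 0 < P ^ 2 - 4 * Q)
    (u v : ℤ) (hu : 0 < u) (hv : 0 < v)
    (h : v ^ 2 - (P ^ 2 - 4 * Q) * u ^ 2 = 4 ∨ v ^ 2 - (P ^ 2 - 4 * Q) * u ^ 2 = -4) :
    (∃ n : ℕ, u = lucasU P Q n) ∧ (∃ m : ℕ, v = lucasV P Q m) := by
  suffices H : ∃ n : ℕ, u = lucasU P Q (n + 1) ∧
      v = P * lucasU P Q (n + 1) - 2 * Q * lucasU P Q n by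
    obtain ⟨n, h₁, h₂⟩ := H
    exact ⟨⟨n + 1, h₁⟩, ⟨n + 1, h₂.trans (lucasV_succ P Q n).symm⟩⟩
  have hdvd : (2 : ℤ) ∣ P * u - v := by
    have hsq : (2 : ℤ) ∣ (P * u - v) ^ 2 := by
      rcases h with h | h
      · exact ⟨v ^ 2 - P * u * v + 2 * Q * u ^ 2 - 2, by
          linear_combination -h⟩
      · exact ⟨v ^ 2 - P * u * v + 2 * Q * u ^ 2 + 2, by linear_combination -h⟩
    exact Int.prime_two.dvd_of_dvd_pow hsq
  obtain ⟨w, hw⟩ := hdvd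
  rcases (abs_eq zero_le_one).1 hQ with rfl | rfl
  · have hP₃ : P ≠ 3 := fun h => hPQ (by rw [h])
    have hP₃_le : 3 ≤ P := by nlinarith
    have hP₄ : 4 ≤ P := by omega
    obtain rfl : v = P * u - 2 * w := by linarith
    have hw₀ : 0 ≤ w := by
      by_contra! hw₀
      rcases h with h | h <;> nlinarith [mul_pos hu (neg_pos.2 hw₀), mul_pos hP hu]
    have hwu : w < u := by
      by_contra! hwu
      rcases h with h | h <;> nlinarith [mul_nonneg (sub_nonneg.2 hwu) hv.le,
        mul_nonneg hu.le (sub_nonneg.2 hwu), mul_pos hu hu,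
        mul_nonneg (sub_nonneg.2 hP₄) (mul_pos hu hu).le,
        mul_nonneg (sub_nonneg.2 hP₄) (mul_nonneg hu.le (sub_nonneg.2 hwu))]
    obtain ⟨n, h₁, h₂⟩ := exists_lucasU_one hP₃ hw₀ hwu (h.imp (by intro h; linarith)
      (by intro h; linarith))
    exact ⟨n, h₁, by rw [← h₁, ← h₂]; ring⟩
  · obtain rfl : v = P * u - 2 * w := by linarith
    have hw₀ : 0 ≤ -w := by
      by_contra! hw₀
      rcases h with h | h <;> nlinarith
    obtain ⟨n, h₁, h₂⟩ := exists_lucasU_neg_one hP hu hw₀ (h.imp (by intro h; linarith)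
      (by intro h; linarith))
    exact ⟨n, h₁, by rw [← h₁, ← h₂]; ring⟩
end

section
/- Let f_1(m,n) = a_1*m^2 + b_1*m*n + c_1*n^2 and f_2(m,n) = a_2*m^2 + b_2*m*n + c_2*n^2 be homogeneous quadratic forms with integer coefficients whose coefficient vectors (a_1,b_1,c_1) and (a_2,b_2,c_2) are linearly independent over the rationals, and let k_1, k_2 be integers with (k_1,k_2) ≠ (0,0). Then the set of integer pairs (m,n) satisfying f_1(m,n) = k_1 and f_2(m,n) = k_2 simultaneously is finite. -/
/-- Two integer points on a common line through the origin at which a binary quadratic form takes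
the same nonzero value have the same coordinates up to sign. -/
theorem mem_signs_of_proportional {a b c k m n m₀ n₀ : ℤ} (hk : k ≠ 0)
    (h₀ : a * m₀ ^ 2 + b * m₀ * n₀ + c * n₀ ^ 2 = k)
    (h : a * m ^ 2 + b * m * n + c * n ^ 2 = k) (hprop : m₀ * n - m * n₀ = 0) :
    (m, n) ∈ ({m₀, -m₀} ×ˢ {n₀, -n₀} : Set (ℤ × ℤ)) := by
  have hm : m ^ 2 = m₀ ^ 2 := by
    apply mul_left_cancel₀ hk
    linear_combination (-m ^ 2) * h₀ + m₀ ^ 2 * h -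
      (b * m * m₀ + c * (m * n₀ + m₀ * n)) * hprop
  have hn : n ^ 2 = n₀ ^ 2 := by
    apply mul_left_cancel₀ hk
    linear_combination (-n ^ 2) * h₀ + n₀ ^ 2 * h +
      (b * n * n₀ + a * (m * n₀ + m₀ * n)) * hprop
  exact ⟨sq_eq_sq_iff_eq_or_eq_neg.mp hm, sq_eq_sq_iff_eq_or_eq_neg.mp hn⟩

/-- A binary quadratic form with three pairwise non-proportional zeros is zero. -/
theorem coeffs_eq_zero_of_three_zeros {A B C m₀ n₀ m₁ n₁ m₂ n₂ : ℤ}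
    (h₀ : A * m₀ ^ 2 + B * m₀ * n₀ + C * n₀ ^ 2 = 0)
    (h₁ : A * m₁ ^ 2 + B * m₁ * n₁ + C * n₁ ^ 2 = 0)
    (h₂ : A * m₂ ^ 2 + B * m₂ * n₂ + C * n₂ ^ 2 = 0)
    (h₀₁ : m₀ * n₁ - m₁ * n₀ ≠ 0) (h₀₂ : m₀ * n₂ - m₂ * n₀ ≠ 0)
    (h₁₂ : m₁ * n₂ - m₂ * n₁ ≠ 0) : A = 0 ∧ B = 0 ∧ C = 0 := by
  have hdet := mul_ne_zero (mul_ne_zero h₀₁ h₀₂) h₁₂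
  refine ⟨mul_left_cancel₀ hdet ?_, mul_left_cancel₀ hdet ?_, mul_left_cancel₀ hdet ?_⟩
  · linear_combination (m₁ * n₁ * n₂ ^ 2 - n₁ ^ 2 * m₂ * n₂) * h₀ -
      (m₀ * n₀ * n₂ ^ 2 - n₀ ^ 2 * m₂ * n₂) * h₁ + (m₀ * n₀ * n₁ ^ 2 - n₀ ^ 2 * m₁ * n₁) * h₂
  · linear_combination -(m₁ ^ 2 * n₂ ^ 2 - n₁ ^ 2 * m₂ ^ 2) * h₀ +
      (m₀ ^ 2 * n₂ ^ 2 - n₀ ^ 2 * m₂ ^ 2) * h₁ - (m₀ ^ 2 * n₁ ^ 2 - n₀ ^ 2 * m₁ ^ 2) * h₂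
  · linear_combination (m₁ ^ 2 * m₂ * n₂ - m₁ * n₁ * m₂ ^ 2) * h₀ -
      (m₀ ^ 2 * m₂ * n₂ - m₀ * n₀ * m₂ ^ 2) * h₁ + (m₀ ^ 2 * m₁ * n₁ - m₀ * n₀ * m₁ ^ 2) * h₂

/-- A set of integer points is finite if a nonzero binary quadratic form vanishes on it and
another binary quadratic form is a nonzero constant on it. -/
theorem finite_of_zero_form_of_const_form {S : Set (ℤ × ℤ)} {A B C a b c k : ℤ} (hk : k ≠ 0)
    (hABC : ¬(A = 0 ∧ B = 0 ∧ C = 0))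
    (hzero : ∀ p ∈ S, A * p.1 ^ 2 + B * p.1 * p.2 + C * p.2 ^ 2 = 0)
    (hconst : ∀ p ∈ S, a * p.1 ^ 2 + b * p.1 * p.2 + c * p.2 ^ 2 = k) : S.Finite := by
  have hfin (p : ℤ × ℤ) : ({p.1, -p.1} ×ˢ {p.2, -p.2} : Set (ℤ × ℤ)).Finite :=
    (Set.toFinite _).prod (Set.toFinite _)
  by_cases hpair : ∃ p ∈ S, ∃ q ∈ S, p.1 * q.2 - q.1 * p.2 ≠ 0
  · obtain ⟨p, hp, q, hq, hpq⟩ := hpair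
    refine ((hfin p).union (hfin q)).subset fun r hr => ?_
    by_cases hpr : p.1 * r.2 - r.1 * p.2 = 0
    · exact Or.inl (mem_signs_of_proportional hk (hconst p hp) (hconst r hr) hpr)
    by_cases hqr : q.1 * r.2 - r.1 * q.2 = 0
    · exact Or.inr (mem_signs_of_proportional hk (hconst q hq) (hconst r hr) hqr)
    exact absurd (coeffs_eq_zero_of_three_zeros (hzero p hp) (hzero q hq) (hzero r hr)
      hpq hpr hqr) hABC
  · push Not at hpair
    rcases S.eq_empty_or_nonempty with rfl | ⟨p, hp⟩
    · exact Set.finite_empty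
    · exact (hfin p).subset fun r hr =>
        mem_signs_of_proportional hk (hconst p hp) (hconst r hr) (hpair p hp r hr)

theorem quad_system_finite (a₁ b₁ c₁ a₂ b₂ c₂ k₁ k₂ : ℤ)
    (hind : LinearIndependent ℚ
      ![![(a₁ : ℚ), (b₁ : ℚ), (c₁ : ℚ)], ![(a₂ : ℚ), (b₂ : ℚ), (c₂ : ℚ)]])
    (hk : (k₁, k₂) ≠ (0, 0)) :
    {p : ℤ × ℤ | a₁ * p.1 ^ 2 + b₁ * p.1 * p.2 + c₁ * p.2 ^ 2 = k₁ ∧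
      a₂ * p.1 ^ 2 + b₂ * p.1 * p.2 + c₂ * p.2 ^ 2 = k₂}.Finite := by
  have hABC : ¬(k₂ * a₁ - k₁ * a₂ = 0 ∧ k₂ * b₁ - k₁ * b₂ = 0 ∧ k₂ * c₁ - k₁ * c₂ = 0) := by
    rintro ⟨ha, hb, hc⟩
    have ha' : (k₂ : ℚ) * a₁ - k₁ * a₂ = 0 := by exact_mod_cast ha
    have hb' : (k₂ : ℚ) * b₁ - k₁ * b₂ = 0 := by exact_mod_cast hb
    have hc' : (k₂ : ℚ) * c₁ - k₁ * c₂ = 0 := by exact_mod_cast hc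
    obtain ⟨h₂, h₁⟩ := LinearIndependent.pair_iff.mp hind (k₂ : ℚ) (-k₁ : ℚ) (by
      ext i
      fin_cases i
      · simpa [sub_eq_add_neg] using ha'
      · simpa [sub_eq_add_neg] using hb'
      · simpa [sub_eq_add_neg] using hc')
    apply hk
    rw [neg_eq_zero] at h₁
    exact Prod.ext (by exact_mod_cast h₁) (by exact_mod_cast h₂)
  have hzero : ∀ p ∈ {p : ℤ × ℤ | a₁ * p.1 ^ 2 + b₁ * p.1 * p.2 + c₁ * p.2 ^ 2 = k₁ ∧
      a₂ * p.1 ^ 2 + b₂ * p.1 * p.2 + c₂ * p.2 ^ 2 = k₂},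
      (k₂ * a₁ - k₁ * a₂) * p.1 ^ 2 + (k₂ * b₁ - k₁ * b₂) * p.1 * p.2 +
        (k₂ * c₁ - k₁ * c₂) * p.2 ^ 2 = 0 := by
    rintro p ⟨h₁, h₂⟩
    linear_combination k₂ * h₁ - k₁ * h₂
  by_cases hk₁ : k₁ = 0
  · have hk₂ : k₂ ≠ 0 := fun hk₂ => hk (Prod.ext hk₁ hk₂)
    exact finite_of_zero_form_of_const_form hk₂ hABC hzero fun p hp => hp.2
  · exact finite_of_zero_form_of_const_form hk₁ hABC hzero fun p hp => hp.1
end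

section
/- Let f(m,n) = a*m^4 + b*m^3*n + c*m^2*n^2 + d*m*n^3 + e*n^4 be a homogeneous integer polynomial of degree 4 and let k be a nonzero integer. If the set of integer pairs (m,n) with f(m,n) = k is infinite, then there exist an integer c' and integers u, v, w such that f(m,n) = c'*(u*m^2 + v*m*n + w*n^2)^2 identically (i.e., as polynomials). -/
open Polynomial

theorem eval_hasseDeriv_eq_sum {F : ℝ[X]} {n : ℕ} (hn : F.natDegree < n) (J : ℕ) (x : ℝ) :
    (hasseDeriv J F).eval x =
      ∑ i ∈ Finset.range n, (i.choose J : ℝ) * F.coeff i * x ^ (i - J) := by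
  rw [hasseDeriv_apply, sum_over_range' _ _ n hn, eval_finsetSum]
  · simp only [eval_monomial]
  · simp

theorem choose_cast_le_two_pow {i n : ℕ} (h : i ≤ n) (J : ℕ) : (i.choose J : ℝ) ≤ 2 ^ n := by
  have : i.choose J ≤ 2 ^ n :=
    (Nat.choose_le_two_pow i J).trans (Nat.pow_le_pow_right (by norm_num) h)
  exact_mod_cast this

theorem abs_eval_hasseDeriv_le {F : ℝ[X]} {n : ℕ} (hn : F.natDegree < n) {H R x : ℝ}
    (hH : ∀ i, |F.coeff i| ≤ H) (hR : 1 ≤ R) (hx : |x| ≤ R) (J : ℕ) :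
    |(hasseDeriv J F).eval x| ≤ n * (2 ^ n * H * R ^ n) := by
  rw [eval_hasseDeriv_eq_sum hn]
  have hH0 : 0 ≤ H := (abs_nonneg _).trans (hH 0)
  have key : ∀ i ∈ Finset.range n,
      |(i.choose J : ℝ) * F.coeff i * x ^ (i - J)| ≤ 2 ^ n * H * R ^ n := by
    intro i hi
    have hin : i ≤ n := (Finset.mem_range.1 hi).le
    rw [abs_mul, abs_mul, abs_pow, Nat.abs_cast]
    have h1 : |x| ^ (i - J) ≤ R ^ n :=
      (pow_le_pow_left₀ (abs_nonneg x) hx _).trans (pow_le_pow_right₀ hR (by omega))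
    have h2 := choose_cast_le_two_pow hin J
    have h3 := hH i
    gcongr
  calc _ ≤ _ := Finset.abs_sum_le_sum_abs _ _
    _ ≤ _ := Finset.sum_le_sum key
    _ = _ := by simp

theorem abs_eval_hasseDeriv_le_of_coeff_eq_zero {F : ℝ[X]} {n N J : ℕ} (hn : F.natDegree < n)
    {H x : ℝ} (hH : ∀ i, |F.coeff i| ≤ H) (hF : ∀ i < N, F.coeff i = 0) (hJ : J ≤ N)
    (hx : |x| ≤ 1) :
    |(hasseDeriv J F).eval x| ≤ n * (2 ^ n * H * |x| ^ (N - J)) := by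
  rw [eval_hasseDeriv_eq_sum hn]
  have hH0 : 0 ≤ H := (abs_nonneg _).trans (hH 0)
  have key : ∀ i ∈ Finset.range n,
      |(i.choose J : ℝ) * F.coeff i * x ^ (i - J)| ≤ 2 ^ n * H * |x| ^ (N - J) := by
    intro i hi
    rcases lt_or_ge i N with hiN | hiN
    · simp only [hF i hiN, mul_zero, zero_mul, abs_zero]
      positivity
    have hin : i ≤ n := (Finset.mem_range.1 hi).le
    rw [abs_mul, abs_mul, abs_pow, Nat.abs_cast]
    have h1 : |x| ^ (i - J) ≤ |x| ^ (N - J) :=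
      pow_le_pow_of_le_one (abs_nonneg x) hx (by omega)
    have h2 := choose_cast_le_two_pow hin J
    have h3 := hH i
    gcongr
  calc _ ≤ _ := Finset.abs_sum_le_sum_abs _ _
    _ ≤ _ := Finset.sum_le_sum key
    _ = _ := by simp

theorem minpoly_pow_dvd_of_X_sub_C_pow_dvd {α : ℝ} (hα : IsIntegral ℚ α) (n : ℕ) (g : ℚ[X])
    (h : (X - C α) ^ n ∣ g.map (algebraMap ℚ ℝ)) : minpoly ℚ α ^ n ∣ g := by
  induction n generalizing g with
  | zero => simp
  | succ n ih =>
    have hroot : aeval α g = 0 := by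
      rw [← eval_map_algebraMap]
      exact dvd_iff_isRoot.1 ((dvd_pow_self _ n.succ_ne_zero).trans h)
    obtain ⟨g₁, rfl⟩ := minpoly.dvd ℚ α hroot
    obtain ⟨u, hu⟩ : X - C α ∣ (minpoly ℚ α).map (algebraMap ℚ ℝ) := by
      rw [dvd_iff_isRoot, IsRoot, eval_map_algebraMap, minpoly.aeval]
    have hsep : ((minpoly ℚ α).map (algebraMap ℚ ℝ)).Separable :=
      (minpoly.irreducible hα).separable.map
    rw [hu] at hsep
    have hcop : IsCoprime (X - C α) u := hsep.isCoprime
    rw [Polynomial.map_mul, hu, pow_succ', mul_assoc] at h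
    have h' := (mul_dvd_mul_iff_left (X_sub_C_ne_zero α)).1 h
    rw [pow_succ']
    exact mul_dvd_mul_left _ (ih g₁ (hcop.pow_left.dvd_of_dvd_mul_left h'))

theorem mul_natDegree_minpoly_le_of_wronskian_eq_zero {α : ℝ} (hα : IsIntegral ℚ α)
    (hirr : Irrational α) {P Q : ℚ[X]} (hPQ : ¬ (P = 0 ∧ Q = 0)) (hW : wronskian P Q = 0) {n : ℕ}
    (h : (X - C α) ^ n ∣ P.map (algebraMap ℚ ℝ) - C α * Q.map (algebraMap ℚ ℝ)) :
    n * (minpoly ℚ α).natDegree ≤ max P.natDegree Q.natDegree := by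
  classical
  have hg : gcd P Q ≠ 0 := fun h0 => hPQ ((gcd_eq_zero_iff _ _).1 h0)
  obtain ⟨P₁, Q₁, hP, hQ, hu⟩ := extract_gcd P Q
  have hcop : IsCoprime P₁ Q₁ := (gcd_isUnit_iff _ _).1 hu
  generalize gcd P Q = g at hg hP hQ
  subst hP hQ
  have hW₁ : wronskian P₁ Q₁ = 0 := by
    have : wronskian (g * P₁) (g * Q₁) = g ^ 2 * wronskian P₁ Q₁ := by
      simp only [wronskian, derivative_mul]
      ring
    rw [this] at hW
    exact (mul_eq_zero.1 hW).resolve_left (pow_ne_zero 2 hg)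
  obtain ⟨h1, h2⟩ := hcop.wronskian_eq_zero_iff.1 hW₁
  obtain ⟨c₁, rfl⟩ := natDegree_eq_zero.1 (derivative_eq_zero.1 h1)
  obtain ⟨c₂, rfl⟩ := natDegree_eq_zero.1 (derivative_eq_zero.1 h2)
  have hc : (c₁ : ℝ) - α * c₂ ≠ 0 := by
    intro h0
    by_cases hc2 : c₂ = 0
    · subst hc2
      have : c₁ = 0 := by simpa using h0
      subst this
      simp at hPQ
    · apply hirr
      refine ⟨c₁ / c₂, ?_⟩
      have : (c₂ : ℝ) ≠ 0 := by exact_mod_cast hc2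
      push_cast
      field_simp
      linarith
  have hdvd : (X - C α) ^ n ∣ g.map (algebraMap ℚ ℝ) := by
    have : (g * C c₁).map (algebraMap ℚ ℝ) - C α * (g * C c₂).map (algebraMap ℚ ℝ) =
        g.map (algebraMap ℚ ℝ) * C ((c₁ : ℝ) - α * c₂) := by
      simp only [Polynomial.map_mul, map_C, C_sub, C_mul, eq_ratCast]
      ring
    rw [this] at h
    exact (isUnit_C.2 (isUnit_iff_ne_zero.2 hc)).dvd_mul_right.1 h
  have hle := natDegree_le_of_dvd (minpoly_pow_dvd_of_X_sub_C_pow_dvd hα n g hdvd) hg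
  rw [natDegree_pow] at hle
  refine hle.trans ?_
  by_cases hc1 : c₁ = 0
  · have hc2 : c₂ ≠ 0 := by rintro rfl; simp [hc1] at hPQ
    exact le_max_of_le_right (natDegree_mul_C hc2).ge
  · exact le_max_of_le_left (natDegree_mul_C hc1).ge

theorem den_pow_le_abs_leadingCoeff {x : ℚ} {W : ℤ[X]} (hW : W ≠ 0) {j : ℕ}
    (h : (X - C x) ^ j ∣ W.map (Int.castRingHom ℚ)) :
    (x.den : ℤ) ^ j ≤ |W.leadingCoeff| := by
  have hprim : (C (x.den : ℤ) * X + C (-x.num) : ℤ[X]).IsPrimitive := by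
    rw [isPrimitive_iff_isUnit_of_C_dvd]
    intro r hr
    rw [C_dvd_iff_dvd_coeff] at hr
    have h0 := hr 0
    have h1 := hr 1
    simp only [coeff_add, mul_coeff_zero, coeff_X_zero, mul_zero, coeff_C_zero, zero_add, coeff_C_mul,
      coeff_X_one, mul_one, coeff_C_succ, add_zero, dvd_neg] at h0 h1
    exact (Int.isCoprime_iff_gcd_eq_one.2 (by simpa [Int.gcd] using x.reduced)).isUnit_of_dvd' h0 h1
  have hmap : (C (x.den : ℤ) * X + C (-x.num) : ℤ[X]).map (Int.castRingHom ℚ) =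
      C (x.den : ℚ) * (X - C x) := by
    have hx : (x.den : ℚ) * x = x.num := by rw [mul_comm, Rat.mul_den_eq_num]
    simp only [Polynomial.map_add, Polynomial.map_mul, map_C, map_X, mul_sub, ← C_mul, hx]
    simp [sub_eq_add_neg]
  have hprim_pow : ((C (x.den : ℤ) * X + C (-x.num) : ℤ[X]) ^ j).IsPrimitive := by
    clear h
    induction j with
    | zero => simp [isPrimitive_one]
    | succ j ih => rw [pow_succ]; exact ih.mul hprim
  have hden : (x.den : ℚ) ≠ 0 := by exact_mod_cast x.den_nz
  have hdvd : (C (x.den : ℤ) * X + C (-x.num) : ℤ[X]) ^ j ∣ W := by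
    rw [IsPrimitive.Int.dvd_iff_map_cast_dvd_map_cast _ _ hprim_pow, Polynomial.map_pow, hmap,
      mul_pow]
    exact ((isUnit_C.2 (isUnit_iff_ne_zero.2 hden)).pow j).mul_left_dvd.2 h
  obtain ⟨V, rfl⟩ := hdvd
  have hlc : (C (x.den : ℤ) * X + C (-x.num) : ℤ[X]).leadingCoeff = x.den :=
    leadingCoeff_linear (by exact_mod_cast x.den_nz)
  rw [leadingCoeff_mul, leadingCoeff_pow, hlc, abs_mul, abs_pow, Nat.abs_cast]
  have : 1 ≤ |V.leadingCoeff| :=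
    Int.one_le_abs (leadingCoeff_ne_zero.2 (right_ne_zero_of_mul hW))
  exact le_mul_of_one_le_right (by positivity) this

theorem exists_int_coords_pow {α : ℝ} {s : Fin 4 → ℤ} (hα : α ^ 4 = ∑ i, (s i : ℝ) * α ^ (i : ℕ)) :
    ∃ B : ℕ, 1 ≤ B ∧ ∃ r : ℕ → Fin 4 → ℤ, ∀ k,
      α ^ k = ∑ i, (r k i : ℝ) * α ^ (i : ℕ) ∧ ∀ i, |r k i| ≤ (B : ℤ) ^ k := by
  obtain ⟨T, hT⟩ : ∃ T : ℕ, ∀ i, |s i| ≤ T :=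
    ⟨∑ i, (s i).natAbs, fun i => by
      rw [Int.abs_eq_natAbs]
      exact_mod_cast Finset.single_le_sum (f := fun i => (s i).natAbs) (fun _ _ => Nat.zero_le _)
        (Finset.mem_univ i)⟩
  refine ⟨1 + T, by omega, ?_⟩
  suffices ∀ k, ∃ r : Fin 4 → ℤ,
      α ^ k = ∑ i, (r i : ℝ) * α ^ (i : ℕ) ∧ ∀ i, |r i| ≤ ((1 + T : ℕ) : ℤ) ^ k by
    choose r hr using this
    exact ⟨r, hr⟩
  intro k
  induction k with
  | zero =>
    refine ⟨![1, 0, 0, 0], by simp [Fin.sum_univ_four], fun i => ?_⟩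
    fin_cases i <;> simp
  | succ k ih =>
    obtain ⟨r, hr, hb⟩ := ih
    refine ⟨![r 3 * s 0, r 0 + r 3 * s 1, r 1 + r 3 * s 2, r 2 + r 3 * s 3], ?_, ?_⟩
    · simp only [Fin.sum_univ_four] at hr hα ⊢
      rw [pow_succ, hr]
      simp at hα ⊢
      linear_combination (r 3 : ℝ) * hα
    · have hmul : ∀ i, |r 3 * s i| ≤ ((1 + T : ℕ) : ℤ) ^ k * T := fun i => by
        rw [abs_mul]
        exact mul_le_mul (hb 3) (hT i) (abs_nonneg _) (by positivity)
      have hadd : ∀ j i, |r j + r 3 * s i| ≤ ((1 + T : ℕ) : ℤ) ^ (k + 1) := fun j i => by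
        refine (abs_add_le _ _).trans ((add_le_add (hb j) (hmul i)).trans_eq ?_)
        push_cast
        ring
      have hpos : (0 : ℤ) ≤ ((1 + T : ℕ) : ℤ) ^ k := by positivity
      intro i
      fin_cases i
      · refine (hmul 0).trans ?_
        rw [pow_succ]
        push_cast at hpos ⊢
        nlinarith
      · exact hadd 0 1
      · exact hadd 1 2
      · exact hadd 2 3

attribute [local instance] Matrix.seminormedAddCommGroup in
theorem exists_approximating_polynomials {α : ℝ} {s : Fin 4 → ℤ}
    (hα : α ^ 4 = ∑ i, (s i : ℝ) * α ^ (i : ℕ)) :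
    ∃ c : ℕ, 1 ≤ c ∧ ∀ M : ℕ, 1 ≤ M → ∃ P Q : ℤ[X], ¬ (P = 0 ∧ Q = 0) ∧
      P.natDegree < 5 * M ∧ Q.natDegree < 5 * M ∧
      (∀ i, |P.coeff i| ≤ (c : ℤ) ^ M) ∧ (∀ i, |Q.coeff i| ≤ (c : ℤ) ^ M) ∧
      (X - C α) ^ (2 * M) ∣ P.map (Int.castRingHom ℝ) - C α * Q.map (Int.castRingHom ℝ) := by
  classical
  obtain ⟨B, hB, r, hr⟩ := exists_int_coords_pow hα
  refine ⟨(20 * (2 ^ 5 * B ^ 6)) ^ 4, Nat.one_le_iff_ne_zero.2 (by positivity), fun M hM => ?_⟩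
  let A : Matrix (Fin (2 * M) × Fin 4) (Fin (5 * M) ⊕ Fin (5 * M)) ℤ := fun ji =>
    Sum.elim (fun k => ((k : ℕ).choose ji.1 : ℤ) * r (k - ji.1) ji.2)
      (fun k => -(((k : ℕ).choose ji.1 : ℤ) * r (k - ji.1 + 1) ji.2))
  have hB' : (1 : ℤ) ≤ B := by exact_mod_cast hB
  have hAentry : ∀ (k : Fin (5 * M)) (j : Fin (2 * M)) (i : Fin 4) (l : ℕ), l ≤ 6 * M →
      |((k : ℕ).choose j : ℤ) * r l i| ≤ ((2 ^ 5 * B ^ 6) ^ M : ℤ) := by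
    intro k j i l hl
    have h1 : ((k : ℕ).choose j : ℤ) ≤ 2 ^ (5 * M) := by
      have : (k : ℕ).choose j ≤ 2 ^ (5 * M) :=
        (Nat.choose_le_two_pow _ _).trans (Nat.pow_le_pow_right (by norm_num) k.2.le)
      exact_mod_cast this
    have h2 : |r l i| ≤ (B : ℤ) ^ (6 * M) := ((hr l).2 i).trans (pow_le_pow_right₀ hB' hl)
    rw [abs_mul, Nat.abs_cast, mul_pow, ← pow_mul, ← pow_mul]
    gcongr
  have hAnorm : ‖A‖ ≤ ((2 ^ 5 * B ^ 6) ^ M : ℝ) := by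
    rw [Matrix.norm_le_iff (by positivity)]
    rintro ⟨j, i⟩ (k | k)
    · rw [Int.norm_eq_abs]
      exact_mod_cast hAentry k j i _ (by omega)
    · rw [Int.norm_eq_abs]
      have := hAentry k j i (k - j + 1) (by omega)
      rw [← abs_neg] at this
      exact_mod_cast this
  obtain ⟨t, ht0, htA, htn⟩ := Int.Matrix.exists_ne_zero_int_vec_norm_le A
    (by simp; omega) (by simp; omega)
  have hM0 : (M : ℝ) ≠ 0 := by positivity
  have htb : ∀ x, |t x| ≤ ((((20 * (2 ^ 5 * B ^ 6)) ^ 4 : ℕ) : ℤ)) ^ M := by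
    intro x
    have h1 : (|t x| : ℝ) ≤ ‖t‖ := by
      have := norm_le_pi_norm t x
      rwa [Int.norm_eq_abs] at this
    have hexp : ((Fintype.card (Fin (2 * M) × Fin 4) : ℝ) /
        ((Fintype.card (Fin (5 * M) ⊕ Fin (5 * M)) : ℝ) -
          (Fintype.card (Fin (2 * M) × Fin 4) : ℝ))) = (4 : ℕ) := by
      simp only [Fintype.card_prod, Fintype.card_sum, Fintype.card_fin]
      push_cast
      rw [show (5 * M + 5 * M - 2 * M * 4 : ℝ) = 2 * M by ring]
      field_simp
    rw [hexp, Real.rpow_natCast] at htn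
    have hMle : (10 * M : ℝ) ≤ 20 ^ M := by
      have h2 : M ≤ 2 ^ M := Nat.lt_two_pow_self.le
      have h3 : 10 ≤ 10 ^ M := by simpa using Nat.pow_le_pow_right (n := 10) (by norm_num) hM
      have : 10 * M ≤ 20 ^ M := by
        rw [show 20 = 10 * 2 by norm_num, mul_pow]
        exact Nat.mul_le_mul h3 h2
      exact_mod_cast this
    have hBr : (1 : ℝ) ≤ B := by exact_mod_cast hB
    have hone : (1 : ℝ) ≤ (2 ^ 5 * B ^ 6) ^ M := by
      apply one_le_pow₀
      have : (1 : ℝ) ≤ B ^ 6 := one_le_pow₀ hBr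
      linarith
    have h4 : (|t x| : ℝ) ≤ ((20 * (2 ^ 5 * B ^ 6)) ^ 4) ^ M := by
      refine h1.trans (htn.trans ?_)
      rw [pow_right_comm, mul_pow _ _ M]
      simp only [Fintype.card_sum, Fintype.card_fin]
      push_cast
      rw [show (5 * M + 5 * M : ℝ) = 10 * M by ring]
      have := max_le hone hAnorm
      gcongr
    exact_mod_cast h4
  have hpos : 0 < 5 * M := by omega
  have hcoeff : ∀ f : Fin (5 * M) → ℤ, (∀ k, |f k| ≤ ((((20 * (2 ^ 5 * B ^ 6)) ^ 4 : ℕ) : ℤ)) ^ M) →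
      ∀ i, |(ofFn (5 * M) f).coeff i| ≤ ((((20 * (2 ^ 5 * B ^ 6)) ^ 4 : ℕ) : ℤ)) ^ M := by
    intro f hf i
    rcases lt_or_ge i (5 * M) with hi | hi
    · rw [ofFn_coeff_eq_val_of_lt _ hi]
      exact hf _
    · rw [ofFn_coeff_eq_zero_of_ge _ hi, abs_zero]
      positivity
  have hval : ∀ (f : Fin (5 * M) → ℤ) (k : Fin (5 * M)), (ofFn (5 * M) f).coeff k = f k :=
    fun f k => by rw [ofFn_coeff_eq_val_of_lt _ k.2]
  refine ⟨ofFn (5 * M) (t ∘ Sum.inl), ofFn (5 * M) (t ∘ Sum.inr), ?_,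
    ofFn_natDegree_lt hpos _, ofFn_natDegree_lt hpos _,
    hcoeff _ fun k => htb _, hcoeff _ fun k => htb _, ?_⟩
  · rintro ⟨hP, hQ⟩
    apply ht0
    ext (k | k)
    · have := hval (t ∘ Sum.inl) k
      rw [hP] at this
      simpa using this.symm
    · have := hval (t ∘ Sum.inr) k
      rw [hQ] at this
      simpa using this.symm
  · rw [X_sub_C_pow_dvd_iff, X_pow_dvd_iff]
    intro j hj
    rw [← taylor_apply, taylor_coeff]
    have hdeg : ((ofFn (5 * M) (t ∘ Sum.inl)).map (Int.castRingHom ℝ) -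
        C α * (ofFn (5 * M) (t ∘ Sum.inr)).map (Int.castRingHom ℝ)).natDegree < 5 * M := by
      refine (natDegree_sub_le _ _).trans_lt (max_lt ?_ ?_)
      · exact natDegree_map_le.trans_lt (ofFn_natDegree_lt hpos _)
      · exact (natDegree_C_mul_le _ _).trans_lt
          (natDegree_map_le.trans_lt (ofFn_natDegree_lt hpos _))
    rw [eval_hasseDeriv_eq_sum hdeg, Finset.sum_range]
    simp only [coeff_sub, coeff_C_mul, coeff_map, hval, Function.comp_apply, eq_intCast]
    have hA : ∀ i : Fin 4, (∑ k : Fin (5 * M), ((k : ℕ).choose j : ℝ) * r (k - j) i * t (Sum.inl k)) +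
        ∑ k : Fin (5 * M), -(((k : ℕ).choose j : ℝ) * r (k - j + 1) i) * t (Sum.inr k) = 0 := by
      intro i
      have := congrFun htA (⟨j, hj⟩, i)
      simp only [Matrix.mulVec, dotProduct, Fintype.sum_sum_type, Pi.zero_apply, A,
        Sum.elim_inl, Sum.elim_inr] at this
      exact_mod_cast this
    have hterm : ∀ k : Fin (5 * M), ((k : ℕ).choose j : ℝ) *
        ((t (Sum.inl k) : ℝ) - α * t (Sum.inr k)) * α ^ ((k : ℕ) - j) =
        ∑ i : Fin 4, α ^ (i : ℕ) * (((k : ℕ).choose j : ℝ) * r (k - j) i * t (Sum.inl k) +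
          -(((k : ℕ).choose j : ℝ) * r (k - j + 1) i) * t (Sum.inr k)) := by
      intro k
      have e1 := (hr (k - j)).1
      have e2 := (hr (k - j + 1)).1
      calc _ = ((k : ℕ).choose j : ℝ) * t (Sum.inl k) * α ^ ((k : ℕ) - j) -
            ((k : ℕ).choose j : ℝ) * t (Sum.inr k) * α ^ ((k : ℕ) - j + 1) := by ring
        _ = _ := by
          rw [e2, e1, Finset.mul_sum, Finset.mul_sum, ← Finset.sum_sub_distrib]
          exact Finset.sum_congr rfl fun i _ => by ring
    rw [Finset.sum_congr rfl fun k _ => hterm k, Finset.sum_comm]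
    refine Finset.sum_eq_zero fun i _ => ?_
    rw [← Finset.mul_sum, Finset.sum_add_distrib, hA i, mul_zero]

theorem abs_leadingCoeff_wronskian_le {P Q : ℤ[X]} {n : ℕ} (hP : P.natDegree < n)
    (hQ : Q.natDegree < n) {H : ℤ} (hPH : ∀ i, |P.coeff i| ≤ H) (hQH : ∀ i, |Q.coeff i| ≤ H)
    (hW : wronskian P Q ≠ 0) : |(wronskian P Q).leadingCoeff| ≤ 4 * n ^ 2 * H ^ 2 := by
  have hH : 0 ≤ H := (abs_nonneg _).trans (hPH 0)
  have hder : ∀ F : ℤ[X], F.natDegree < n → (∀ i, |F.coeff i| ≤ H) →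
      ∀ i, |(derivative F).coeff i| ≤ H * n := by
    intro F hF hFH i
    rw [coeff_derivative]
    rcases lt_or_ge (i + 1) n with hi | hi
    · rw [abs_mul, abs_of_nonneg (by positivity : (0 : ℤ) ≤ (i : ℤ) + 1)]
      exact mul_le_mul (hFH _) (by exact_mod_cast hi.le) (by positivity) hH
    · rw [coeff_eq_zero_of_natDegree_lt (hF.trans_le hi), zero_mul, abs_zero]
      positivity
  have hmul : ∀ F G : ℤ[X], (∀ i, |F.coeff i| ≤ H) → (∀ i, |G.coeff i| ≤ H * n) →
      ∀ i < 2 * n, |(F * G).coeff i| ≤ 2 * n * (H * (H * n)) := by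
    intro F G hF hG i hi
    rw [coeff_mul]
    refine (Finset.abs_sum_le_sum_abs _ _).trans
      ((Finset.sum_le_card_nsmul _ _ (H * (H * n)) fun p _ => ?_).trans ?_)
    · rw [abs_mul]
      exact mul_le_mul (hF _) (hG _) (abs_nonneg _) hH
    · rw [Finset.Nat.card_antidiagonal, nsmul_eq_mul]
      have : ((i + 1 : ℕ) : ℤ) ≤ 2 * n := by exact_mod_cast hi
      exact mul_le_mul_of_nonneg_right this (by positivity)
  have hdeg : (wronskian P Q).natDegree < 2 * n :=
    (natDegree_wronskian_lt_add hW).trans (by omega)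
  rw [leadingCoeff]
  set i := (wronskian P Q).natDegree
  have h1 := hmul P (derivative Q) hPH (hder Q hQ hQH) i hdeg
  have h2 := hmul Q (derivative P) hQH (hder P hP hPH) i hdeg
  rw [wronskian, coeff_sub, mul_comm (derivative P)]
  calc _ ≤ _ := abs_sub _ _
    _ ≤ _ := add_le_add h1 h2
    _ = _ := by ring

theorem exists_order_le_and_eval_hasseDeriv_ne_zero {P Q : ℤ[X]} (hW : wronskian P Q ≠ 0)
    (x y : ℚ) :
    ∃ J : ℕ, (x.den : ℤ) ^ (J - 1) ≤ |(wronskian P Q).leadingCoeff| ∧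
      ((hasseDeriv J (C (y.den : ℤ) * P - C y.num * Q)).map (Int.castRingHom ℚ)).eval x ≠ 0 := by
  set G : ℤ[X] := C (y.den : ℤ) * P - C y.num * Q with hG
  have hWG : C (y.den : ℤ) * wronskian P Q = G * derivative Q - derivative G * Q := by
    simp only [hG, wronskian, derivative_sub, derivative_C_mul]
    ring
  have hWd : C (y.den : ℤ) * wronskian P Q ≠ 0 :=
    mul_ne_zero (C_ne_zero.2 (by exact_mod_cast y.den_nz)) hW
  have hG0 : G ≠ 0 := by
    intro h0
    rw [hWG, h0] at hWd
    simp at hWd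
  have hGm : G.map (Int.castRingHom ℚ) ≠ 0 :=
    (Polynomial.map_ne_zero_iff (Int.castRingHom ℚ).injective_int).2 hG0
  set J := (G.map (Int.castRingHom ℚ)).rootMultiplicity x with hJ
  refine ⟨J, ?_, ?_⟩
  · apply den_pow_le_abs_leadingCoeff hW
    have hdvd : (X - C x) ^ J ∣ G.map (Int.castRingHom ℚ) := pow_rootMultiplicity_dvd _ _
    have h1 : (X - C x) ^ (J - 1) ∣ G.map (Int.castRingHom ℚ) :=
      (pow_dvd_pow _ (Nat.sub_le _ _)).trans hdvd
    have h2 : (X - C x) ^ (J - 1) ∣ derivative (G.map (Int.castRingHom ℚ)) :=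
      pow_sub_one_dvd_derivative_of_pow_dvd hdvd
    have h3 := congrArg (Polynomial.map (Int.castRingHom ℚ)) hWG
    rw [Polynomial.map_mul, map_C, Polynomial.map_sub, Polynomial.map_mul, Polynomial.map_mul,
      ← derivative_map, ← derivative_map] at h3
    have hu : IsUnit (C ((Int.castRingHom ℚ) (y.den : ℤ))) :=
      isUnit_C.2 (isUnit_iff_ne_zero.2 (by simp))
    rw [← hu.dvd_mul_left, h3]
    exact dvd_sub (h1.mul_right _) (h2.mul_right _)
  · have hmap : (hasseDeriv J G).map (Int.castRingHom ℚ) =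
        hasseDeriv J (G.map (Int.castRingHom ℚ)) := by
      ext i
      simp [hasseDeriv_coeff]
    rw [hmap, ← taylor_coeff, taylor_apply, hJ, rootMultiplicity_eq_natTrailingDegree]
    exact trailingCoeff_nonzero_iff_nonzero.2 (comp_X_add_C_ne_zero_iff.2 hGm)

theorem one_le_den_pow_mul_abs_eval_hasseDeriv {G : ℤ[X]} {n : ℕ} (hG : G.natDegree < n) {x : ℚ}
    {J : ℕ} (h : ((hasseDeriv J G).map (Int.castRingHom ℚ)).eval x ≠ 0) :
    (1 : ℝ) ≤ (x.den : ℝ) ^ n * |(hasseDeriv J (G.map (Int.castRingHom ℝ))).eval (x : ℝ)| := by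
  have hmap : hasseDeriv J (G.map (Int.castRingHom ℝ)) =
      (hasseDeriv J G).map (algebraMap ℤ ℝ) := by
    ext i
    simp [hasseDeriv_coeff]
  have hx : ((x.num : ℤ) : ℝ) / ((x.den : ℤ) : ℝ) = (x : ℝ) := by
    exact_mod_cast congrArg (Rat.cast : ℚ → ℝ) x.num_div_den
  have hne : eval (((x.num : ℤ) : ℝ) / ((x.den : ℤ) : ℝ))
      ((hasseDeriv J G).map (algebraMap ℤ ℝ)) ≠ 0 := by
    rw [hx]
    have : (hasseDeriv J G).map (algebraMap ℤ ℝ) =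
        ((hasseDeriv J G).map (Int.castRingHom ℚ)).map (algebraMap ℚ ℝ) := by
      rw [Polynomial.map_map]
      congr 1
    rw [this, show (x : ℝ) = algebraMap ℚ ℝ x from rfl, eval_map_algebraMap, aeval_algebraMap_apply]
    simpa [coe_aeval_eq_eval] using h
  have h1 := one_le_pow_mul_abs_eval_div (K := ℝ) (f := hasseDeriv J G) (a := x.num)
    (b := (x.den : ℤ)) (by exact_mod_cast x.pos) hne
  rw [hx] at h1
  rw [hmap]
  refine h1.trans (mul_le_mul_of_nonneg_right ?_ (abs_nonneg _))
  have hden : (1 : ℝ) ≤ x.den := by exact_mod_cast x.pos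
  have hle : (hasseDeriv J G).natDegree ≤ n :=
    (natDegree_hasseDeriv_le G J).trans ((Nat.sub_le _ _).trans hG.le)
  simpa using pow_le_pow_right₀ hden hle

theorem abs_eval_hasseDeriv_le_of_X_sub_C_pow_dvd {α : ℝ} {P Q : ℝ[X]} {n N J : ℕ}
    (hP : P.natDegree < n) (hQ : Q.natDegree < n) {H R x : ℝ}
    (hPH : ∀ i, |P.coeff i| ≤ H) (hQH : ∀ i, |Q.coeff i| ≤ H) (hR : 1 ≤ R) (hα : |α| ≤ R)
    (hxR : |x| ≤ R) (hx : |α - x| ≤ 1) (hdvd : (X - C α) ^ N ∣ P - C α * Q) (hJ : J ≤ N)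
    (y : ℝ) :
    |(hasseDeriv J (P - C y * Q)).eval x| ≤
      n ^ 2 * (4 ^ n * (H * (1 + R)) * R ^ n) * (|α - x| ^ (N - J) + |α - y|) := by
  have hH : 0 ≤ H := (abs_nonneg _).trans (hPH 0)
  have hR0 : 0 ≤ R := by linarith
  have hn : (1 : ℝ) ≤ n := by exact_mod_cast (by omega : 1 ≤ n)
  set S := P - C α * Q with hS
  have hSdeg : S.natDegree < n :=
    (natDegree_sub_le _ _).trans_lt (max_lt hP ((natDegree_C_mul_le _ _).trans_lt hQ))
  have hSH : ∀ i, |S.coeff i| ≤ H * (1 + R) := by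
    intro i
    rw [hS, coeff_sub, coeff_C_mul]
    calc _ ≤ |P.coeff i| + |α * Q.coeff i| := abs_sub _ _
      _ = |P.coeff i| + |α| * |Q.coeff i| := by rw [abs_mul]
      _ ≤ H + R * H := add_le_add (hPH i) (mul_le_mul hα (hQH i) (abs_nonneg _) hR0)
      _ = _ := by ring
  have hTdeg : (taylor α S).natDegree < n := by rwa [natDegree_taylor]
  have hTH : ∀ i, |(taylor α S).coeff i| ≤ n * (2 ^ n * (H * (1 + R)) * R ^ n) := fun i => by
    rw [taylor_coeff]
    exact abs_eval_hasseDeriv_le hSdeg hSH hR hα i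
  have hT0 : ∀ i < N, (taylor α S).coeff i = 0 := by
    rw [taylor_apply, ← X_pow_dvd_iff, ← X_sub_C_pow_dvd_iff]
    exact hdvd
  have hSx : (hasseDeriv J S).eval x = (hasseDeriv J (taylor α S)).eval (x - α) := by
    rw [← taylor_coeff, ← taylor_coeff, taylor_taylor, sub_add_cancel]
  have h1 : |(hasseDeriv J S).eval x| ≤
      n * (2 ^ n * (n * (2 ^ n * (H * (1 + R)) * R ^ n)) * |α - x| ^ (N - J)) := by
    rw [hSx, abs_sub_comm α x]
    exact abs_eval_hasseDeriv_le_of_coeff_eq_zero hTdeg hTH hT0 hJ (by rwa [abs_sub_comm])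
  have h2 : |(hasseDeriv J Q).eval x| ≤ n * (2 ^ n * H * R ^ n) :=
    abs_eval_hasseDeriv_le hQ hQH hR hxR J
  have hsplit : P - C y * Q = S + C (α - y) * Q := by
    rw [hS, C_sub]
    ring
  have h3 : (hasseDeriv J (P - C y * Q)).eval x =
      (hasseDeriv J S).eval x + (α - y) * (hasseDeriv J Q).eval x := by
    rw [hsplit, map_add, eval_add, ← smul_eq_C_mul, map_smul, eval_smul, smul_eq_mul]
  have h4 : n * (2 ^ n * H * R ^ n) ≤ n ^ 2 * (4 ^ n * (H * (1 + R)) * R ^ n) := by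
    have e1 : (n : ℝ) ≤ n ^ 2 := by nlinarith
    have e2 : (2 : ℝ) ^ n ≤ 4 ^ n := pow_le_pow_left₀ (by norm_num) (by norm_num) n
    have e3 : H ≤ H * (1 + R) := by nlinarith
    gcongr
  rw [h3]
  calc _ ≤ |(hasseDeriv J S).eval x| + |α - y| * |(hasseDeriv J Q).eval x| := by
        rw [← abs_mul]; exact abs_add_le _ _
    _ ≤ n * (2 ^ n * (n * (2 ^ n * (H * (1 + R)) * R ^ n)) * |α - x| ^ (N - J)) +
        |α - y| * (n ^ 2 * (4 ^ n * (H * (1 + R)) * R ^ n)) :=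
      add_le_add h1 (mul_le_mul_of_nonneg_left (h2.trans h4) (abs_nonneg _))
    _ = _ := by
      rw [show (4 : ℝ) ^ n = 2 ^ n * 2 ^ n by rw [← mul_pow]; norm_num]
      ring

theorem thue_upper_bound_lt_one {q d K C : ℝ} {M J : ℕ} (hK : 1 ≤ K) (hC : 1 ≤ C)
    (hq : 1 < q) (hKq : (2 * (K * C ^ 2)) ^ 10 ≤ q) (hd₁ : q ^ (2 * M) ≤ d)
    (hd₂ : d ≤ q ^ (2 * M + 2)) (hM : 13 ≤ M) (hJ : 10 * (J - 1) ≤ M) :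
    q ^ (5 * M) * d * (K ^ M * ((C / q ^ 4) ^ (2 * M - J) + C / d ^ 4)) < 1 := by
  have hq0 : 0 < q := by linarith
  have hd0 : 0 < d := (pow_pos hq0 _).trans_le hd₁
  have hA : (2 * (K * C ^ 2) ^ M) ^ 10 ≤ q ^ M := by
    calc (2 * (K * C ^ 2) ^ M) ^ 10 ≤ (2 ^ M * (K * C ^ 2) ^ M) ^ 10 := by
          gcongr
          exact le_self_pow₀ (by norm_num) (by omega)
      _ = ((2 * (K * C ^ 2)) ^ 10) ^ M := by rw [← mul_pow, pow_right_comm]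
      _ ≤ q ^ M := by gcongr
  have hKM : 1 ≤ K ^ M := one_le_pow₀ hK
  set A := (K * C ^ 2) ^ M with hAdef
  have hA0 : 0 < A := by positivity
  have key : ∀ i j : ℕ, 10 * i + M < 10 * j → 2 * A * q ^ i < q ^ j := by
    intro i j hij
    refine lt_of_pow_lt_pow_left₀ 10 (by positivity) ?_
    calc (2 * A * q ^ i) ^ 10 = (2 * A) ^ 10 * q ^ (10 * i) := by ring
      _ ≤ q ^ M * q ^ (10 * i) := by gcongr
      _ = q ^ (10 * i + M) := by ring
      _ < q ^ (10 * j) := pow_lt_pow_right₀ hq hij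
      _ = (q ^ j) ^ 10 := by ring
  have h1 : q ^ (5 * M) * d * (K ^ M * (C / q ^ 4) ^ (2 * M - J)) < 1 / 2 := by
    have hCp : C ^ (2 * M - J) ≤ C ^ (2 * M) := pow_le_pow_right₀ hC (Nat.sub_le _ _)
    have hk := key (7 * M + 2) (4 * (2 * M - J)) (by omega)
    calc q ^ (5 * M) * d * (K ^ M * (C / q ^ 4) ^ (2 * M - J))
        ≤ q ^ (5 * M) * q ^ (2 * M + 2) * (K ^ M * (C ^ (2 * M) / q ^ (4 * (2 * M - J)))) := by
          rw [div_pow, ← pow_mul]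
          gcongr
      _ = A * q ^ (7 * M + 2) / q ^ (4 * (2 * M - J)) := by
          rw [hAdef, mul_pow, ← pow_mul]
          ring
      _ < 1 / 2 := by
          rw [div_lt_iff₀ (by positivity)]
          linarith
  have h2 : q ^ (5 * M) * d * (K ^ M * (C / d ^ 4)) < 1 / 2 := by
    have hk := key (5 * M) (6 * M) (by omega)
    have hd3 : q ^ (6 * M) ≤ d ^ 3 := by
      calc q ^ (6 * M) = (q ^ (2 * M)) ^ 3 := by ring
        _ ≤ d ^ 3 := by gcongr
    have hKC : K ^ M * C ≤ A := by
      rw [hAdef, mul_pow, ← pow_mul]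
      gcongr
      exact le_self_pow₀ hC (by omega)
    calc q ^ (5 * M) * d * (K ^ M * (C / d ^ 4)) = (K ^ M * C) * q ^ (5 * M) / d ^ 3 := by
          field_simp
      _ ≤ A * q ^ (5 * M) / d ^ 3 := by gcongr
      _ < 1 / 2 := by
          rw [div_lt_iff₀ (by positivity)]
          linarith
  calc _ = q ^ (5 * M) * d * (K ^ M * (C / q ^ 4) ^ (2 * M - J)) +
        q ^ (5 * M) * d * (K ^ M * (C / d ^ 4)) := by ring
    _ < 1 := by linarith

theorem exists_thue_constant {α : ℝ} {s : Fin 4 → ℤ} (hα : α ^ 4 = ∑ i, (s i : ℝ) * α ^ (i : ℕ))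
    (hα_int : IsIntegral ℚ α) (hirr : Irrational α) (hdeg : (minpoly ℚ α).natDegree = 4) :
    ∃ K : ℝ, 1 ≤ K ∧ ∀ M : ℕ, 1 ≤ M → ∀ x y : ℚ, |α - x| ≤ 1 → ∃ J : ℕ,
      (x.den : ℝ) ^ (J - 1) ≤ K ^ M ∧ (J ≤ 2 * M →
        1 ≤ (x.den : ℝ) ^ (5 * M) * y.den * (K ^ M * (|α - x| ^ (2 * M - J) + |α - y|))) := by
  obtain ⟨c, hc, hPQ⟩ := exists_approximating_polynomials hα
  have hc' : (1 : ℝ) ≤ c := by exact_mod_cast hc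
  set R : ℝ := |α| + 1 with hR
  have hR1 : 1 ≤ R := by simp [hR]
  have hK1 : 0 ≤ 25 * 4 * 4 ^ 5 * c * (1 + R) * R ^ 5 := by positivity
  have hK2 : (1 : ℝ) ≤ 400 * c ^ 2 := by nlinarith
  refine ⟨400 * c ^ 2 + 25 * 4 * 4 ^ 5 * c * (1 + R) * R ^ 5, by linarith,
    fun M hM x y hx => ?_⟩
  set K : ℝ := 400 * c ^ 2 + 25 * 4 * 4 ^ 5 * c * (1 + R) * R ^ 5 with hK
  obtain ⟨P, Q, hne, hP, hQ, hPc, hQc, hdvd⟩ := hPQ M hM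
  have hmapmap : ∀ F : ℤ[X], (F.map (Int.castRingHom ℚ)).map (algebraMap ℚ ℝ) =
      F.map (Int.castRingHom ℝ) := fun F => by
    rw [Polynomial.map_map]
    congr 1
  have hinj : Function.Injective (Int.castRingHom ℚ) := (Int.castRingHom ℚ).injective_int
  have hW : wronskian P Q ≠ 0 := by
    intro h0
    have h0' : wronskian (P.map (Int.castRingHom ℚ)) (Q.map (Int.castRingHom ℚ)) = 0 := by
      have := congrArg (Polynomial.map (Int.castRingHom ℚ)) h0
      simpa [wronskian, derivative_map] using this
    have h1 := mul_natDegree_minpoly_le_of_wronskian_eq_zero hα_int hirr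
      (by rwa [Polynomial.map_eq_zero_iff hinj, Polynomial.map_eq_zero_iff hinj]) h0'
      (n := 2 * M) (by rwa [hmapmap, hmapmap])
    rw [natDegree_map_eq_of_injective hinj, natDegree_map_eq_of_injective hinj, hdeg] at h1
    have := max_lt hP hQ
    omega
  have hMM : (M : ℝ) ^ 2 ≤ 4 ^ M := by
    have h2 : M ≤ 2 ^ M := Nat.lt_two_pow_self.le
    have : (M : ℝ) ≤ 2 ^ M := by exact_mod_cast h2
    calc (M : ℝ) ^ 2 ≤ (2 ^ M) ^ 2 := by gcongr
      _ = 4 ^ M := by rw [pow_right_comm]; norm_num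
  obtain ⟨J, hJ, hJne⟩ := exists_order_le_and_eval_hasseDeriv_ne_zero hW x y
  refine ⟨J, ?_, fun hJM => ?_⟩
  · have h1 := hJ.trans (abs_leadingCoeff_wronskian_le hP hQ hPc hQc hW)
    have h2 : (x.den : ℝ) ^ (J - 1) ≤ 4 * (5 * M) ^ 2 * (c ^ M) ^ 2 := by exact_mod_cast h1
    calc _ ≤ _ := h2
      _ = 100 * (M : ℝ) ^ 2 * (c ^ 2) ^ M := by ring
      _ ≤ 100 ^ M * 4 ^ M * (c ^ 2) ^ M := by
          gcongr
          exact le_self_pow₀ (by norm_num) (by omega)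
      _ = (400 * c ^ 2) ^ M := by rw [← mul_pow, ← mul_pow]; norm_num
      _ ≤ K ^ M := by
          gcongr
          linarith
  · have hGdeg : (C (y.den : ℤ) * P - C y.num * Q).natDegree < 5 * M :=
      (natDegree_sub_le _ _).trans_lt
        (max_lt ((natDegree_C_mul_le _ _).trans_lt hP) ((natDegree_C_mul_le _ _).trans_lt hQ))
    have h1 := one_le_den_pow_mul_abs_eval_hasseDeriv hGdeg hJne
    have hcast : ∀ F : ℤ[X], (∀ i, |F.coeff i| ≤ (c : ℤ) ^ M) →
        ∀ i, |(F.map (Int.castRingHom ℝ)).coeff i| ≤ (c : ℝ) ^ M := fun F hF i => by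
      rw [coeff_map, eq_intCast]
      exact_mod_cast hF i
    have hyd : (y.den : ℝ) * y = y.num := by
      exact_mod_cast congrArg (Rat.cast : ℚ → ℝ) ((mul_comm _ _).trans (Rat.mul_den_eq_num y))
    have hG : (C (y.den : ℤ) * P - C y.num * Q).map (Int.castRingHom ℝ) =
        (y.den : ℝ) • (P.map (Int.castRingHom ℝ) - C (y : ℝ) * Q.map (Int.castRingHom ℝ)) := by
      rw [smul_eq_C_mul, mul_sub, ← mul_assoc, ← C_mul, hyd]
      simp
    have hxR : |(x : ℝ)| ≤ R := by
      have h5 := abs_sub_abs_le_abs_sub (x : ℝ) α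
      rw [abs_sub_comm] at h5
      linarith
    have h2 := abs_eval_hasseDeriv_le_of_X_sub_C_pow_dvd (natDegree_map_le.trans_lt hP)
      (natDegree_map_le.trans_lt hQ) (hcast P hPc) (hcast Q hQc) hR1 (by linarith) hxR hx hdvd hJM
      (y : ℝ)
    rw [hG, map_smul, eval_smul, smul_eq_mul, abs_mul, Nat.abs_cast] at h1
    have h3 : (((5 * M : ℕ) : ℝ)) ^ 2 * (4 ^ (5 * M) * ((c : ℝ) ^ M * (1 + R)) * R ^ (5 * M)) ≤
        K ^ M := by
      calc _ = 25 * (M : ℝ) ^ 2 * (4 ^ 5) ^ M * c ^ M * (1 + R) * (R ^ 5) ^ M := by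
            rw [pow_mul 4, pow_mul R]
            push_cast
            ring
        _ ≤ 25 ^ M * 4 ^ M * (4 ^ 5) ^ M * c ^ M * (1 + R) ^ M * (R ^ 5) ^ M := by
            gcongr
            · exact le_self_pow₀ (by norm_num) (by omega)
            · exact le_self_pow₀ (by linarith) (by omega)
        _ = (25 * 4 * 4 ^ 5 * c * (1 + R) * R ^ 5) ^ M := by simp only [mul_pow]
        _ ≤ K ^ M := by
            gcongr
            linarith
    calc (1 : ℝ) ≤ _ := h1
      _ ≤ (x.den : ℝ) ^ (5 * M) * (y.den * (K ^ M * (|α - x| ^ (2 * M - J) + |α - y|))) := by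
          gcongr
          exact h2.trans (mul_le_mul_of_nonneg_right h3 (by positivity))
      _ = _ := by ring

theorem finite_rat_abs_sub_le_den_lt (α C : ℝ) (N : ℕ) :
    {x : ℚ | |α - x| ≤ C ∧ x.den < N}.Finite := by
  obtain ⟨T, hT⟩ := exists_nat_ge ((|α| + C) * N)
  refine (((Set.finite_Icc (-(T : ℤ)) T).prod (Set.finite_Iio N)).image
    fun p : ℤ × ℕ => (p.1 : ℚ) / p.2).subset ?_
  rintro x ⟨hx, hN⟩
  refine ⟨(x.num, x.den), ⟨?_, hN⟩, x.num_div_den⟩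
  rw [Set.mem_Icc, ← abs_le]
  have h1 : |(x : ℝ)| ≤ |α| + C := by
    have h5 := abs_sub_abs_le_abs_sub (x : ℝ) α
    rw [abs_sub_comm] at h5
    linarith
  have h2 : ((x.num : ℤ) : ℝ) = x * x.den := by
    exact_mod_cast congrArg (Rat.cast : ℚ → ℝ) (Rat.mul_den_eq_num x).symm
  have h3 : (x.den : ℝ) ≤ N := by exact_mod_cast hN.le
  have h4 : |((x.num : ℤ) : ℝ)| ≤ T := by
    rw [h2, abs_mul, Nat.abs_cast]
    refine le_trans ?_ hT
    have := abs_nonneg (x : ℝ)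
    gcongr
    linarith
  exact_mod_cast h4

/-- Thue's theorem for real algebraic integers of degree four, with exponent four. -/
theorem finite_rat_abs_sub_le_div_den_pow_four {α : ℝ} {s : Fin 4 → ℤ}
    (hα : α ^ 4 = ∑ i, (s i : ℝ) * α ^ (i : ℕ)) (hα_int : IsIntegral ℚ α) (hirr : Irrational α)
    (hdeg : (minpoly ℚ α).natDegree = 4) (C : ℝ) :
    {x : ℚ | |α - x| ≤ C / x.den ^ 4}.Finite := by
  wlog hC : 1 ≤ C generalizing C
  · refine (this 1 le_rfl).subset fun x hx => ?_
    exact le_trans (b := C / (x.den : ℝ) ^ 4) hx (by gcongr; linarith)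
  by_contra hinf
  have hlarge : ∀ N : ℕ, ∃ x : ℚ, |α - x| ≤ C / x.den ^ 4 ∧ N ≤ x.den := by
    intro N
    by_contra! hN
    refine hinf ((finite_rat_abs_sub_le_den_lt α C N).subset fun x hx => ⟨?_, hN x hx⟩)
    have : (1 : ℝ) ≤ x.den := by exact_mod_cast x.pos
    exact (hx : _ ≤ _).trans (div_le_self (by linarith) (one_le_pow₀ this))
  obtain ⟨K, hK, h⟩ := exists_thue_constant hα hα_int hirr hdeg
  obtain ⟨N₀, hN₀⟩ := exists_nat_ge ((2 * (K * C ^ 2)) ^ 10)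
  obtain ⟨N₁, hN₁⟩ := exists_nat_ge C
  obtain ⟨x, hx, hxN⟩ := hlarge (N₀ + N₁ + 2)
  have hq2 : 2 ≤ x.den := by omega
  obtain ⟨y, hy, hyN⟩ := hlarge ((x.den ^ 2) ^ 13)
  have hxN' : (N₀ : ℝ) + N₁ + 2 ≤ x.den := by exact_mod_cast hxN
  have hq1 : (1 : ℝ) < x.den := by
    have h0 : (0 : ℝ) ≤ N₀ := by positivity
    have h1 : (0 : ℝ) ≤ N₁ := by positivity
    linarith
  have hx1 : |α - x| ≤ 1 := by
    refine hx.trans ((div_le_one (by positivity)).2 ?_)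
    have h0 : (0 : ℝ) ≤ N₀ := by positivity
    have h1 : (x.den : ℝ) ≤ (x.den : ℝ) ^ 4 := le_self_pow₀ hq1.le (by norm_num)
    linarith
  have hbase : 1 < x.den ^ 2 := Nat.one_lt_pow (by norm_num) (by omega)
  set M := Nat.log (x.den ^ 2) y.den with hM
  have hM13 : 13 ≤ M := by
    exact Nat.le_log_of_pow_le hbase hyN
  have hd₁ : x.den ^ (2 * M) ≤ y.den := by
    rw [pow_mul]
    exact Nat.pow_log_le_self _ y.den_nz
  have hd₂ : y.den ≤ x.den ^ (2 * M + 2) := by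
    rw [show 2 * M + 2 = 2 * (M + 1) by ring, pow_mul]
    exact (Nat.lt_pow_succ_log_self hbase _).le
  have hKq : (2 * (K * C ^ 2)) ^ 10 ≤ x.den := by
    have h1 : (0 : ℝ) ≤ N₁ := by positivity
    linarith
  obtain ⟨J, hJ, hJb⟩ := h M (by omega) x y hx1
  have hJM : 10 * (J - 1) ≤ M := by
    have h1 : K ^ 10 ≤ x.den := by
      refine le_trans ?_ hKq
      gcongr
      nlinarith [one_le_pow₀ hC (n := 2)]
    have h2 : (x.den : ℝ) ^ (10 * (J - 1)) ≤ (x.den : ℝ) ^ M := by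
      calc (x.den : ℝ) ^ (10 * (J - 1)) = ((x.den : ℝ) ^ (J - 1)) ^ 10 := by ring
        _ ≤ (K ^ M) ^ 10 := by gcongr
        _ = (K ^ 10) ^ M := by ring
        _ ≤ _ := by gcongr
    exact (pow_le_pow_iff_right₀ hq1).1 h2
  have h1 := hJb (by omega)
  have h2 := thue_upper_bound_lt_one hK hC hq1 hKq (d := y.den) (by exact_mod_cast hd₁)
    (by exact_mod_cast hd₂) hM13 hJM
  refine absurd h1 (not_le.2 (lt_of_le_of_lt ?_ h2))
  gcongr

theorem coeffs_eq_zero_of_infinite_roots {a b c d : ℚ}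
    (h : {x : ℚ | a * x ^ 3 + b * x ^ 2 + c * x + d = 0}.Infinite) :
    a = 0 ∧ b = 0 ∧ c = 0 ∧ d = 0 := by
  have hp : C a * X ^ 3 + C b * X ^ 2 + C c * X + C d = 0 := by
    apply eq_zero_of_infinite_isRoot
    simpa [IsRoot] using h
  refine ⟨?_, ?_, ?_, ?_⟩
  · simpa [coeff_X, coeff_C] using congrArg (fun p : ℚ[X] => p.coeff 3) hp
  · simpa [coeff_X, coeff_C] using congrArg (fun p : ℚ[X] => p.coeff 2) hp
  · simpa [coeff_X, coeff_C] using congrArg (fun p : ℚ[X] => p.coeff 1) hp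
  · simpa using congrArg (fun p : ℚ[X] => p.coeff 0) hp

theorem infinite_fiber_of_dvd {S : Set (ℤ × ℤ)} (hS : S.Infinite) {k : ℤ} (hk : k ≠ 0)
    {φ : ℤ × ℤ → ℤ} (hφ : ∀ p ∈ S, φ p ∣ k) : ∃ s, s ∣ k ∧ (S ∩ φ ⁻¹' {s}).Infinite := by
  by_contra! hfin
  have hdiv : {z : ℤ | z ∣ k}.Finite :=
    (Set.finite_Icc (-|k|) |k|).subset fun z hz =>
      abs_le.1 (Int.le_of_dvd (abs_pos.2 hk) ((abs_dvd_abs z k).2 hz))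
  refine hS (Set.Finite.of_finite_fibers φ (hdiv.subset ?_) ?_)
  · rintro _ ⟨p, hp, rfl⟩
    exact hφ p hp
  · rintro _ ⟨p, hp, rfl⟩
    exact hfin _ (hφ p hp)

theorem infinite_image_div {S : Set (ℤ × ℤ)} (hS : S.Infinite) {b c d e k : ℤ} (hk : k ≠ 0)
    (h : ∀ p ∈ S, p.1 ^ 4 + b * p.1 ^ 3 * p.2 + c * p.1 ^ 2 * p.2 ^ 2 + d * p.1 * p.2 ^ 3 +
      e * p.2 ^ 4 = k) :
    ((fun p : ℤ × ℤ => (p.1 : ℚ) / p.2) '' (S ∩ {p | p.2 ≠ 0})).Infinite := by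
  have hS' : (S ∩ {p | p.2 ≠ 0}).Infinite := by
    have hfin : (S ∩ {p | p.2 = 0}).Finite := by
      refine ((Set.finite_Icc (-|k|) |k|).prod (Set.finite_singleton (0 : ℤ))).subset ?_
      rintro ⟨m, n⟩ ⟨hp, hn⟩
      have hn' : n = 0 := hn
      subst hn'
      refine ⟨abs_le.1 (Int.le_of_dvd (abs_pos.2 hk) ((abs_dvd_abs m k).2 ?_)), rfl⟩
      have := h _ hp
      exact ⟨m ^ 3, by simp at this; rw [← this]; ring⟩
    refine (hS.sdiff hfin).mono fun p hp => ⟨hp.1, fun h0 => hp.2 ⟨hp.1, h0⟩⟩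
  refine fun hfin => hS' (Set.Finite.of_finite_fibers _ hfin ?_)
  rintro _ ⟨⟨m₀, n₀⟩, ⟨hp₀, hn₀⟩, rfl⟩
  have hn₀' : (n₀ : ℚ) ≠ 0 := by exact_mod_cast hn₀
  refine ((Set.finite_Icc (-|m₀|) |m₀|).prod (Set.finite_Icc (-|n₀|) |n₀|)).subset ?_
  rintro ⟨m, n⟩ ⟨⟨hp, hn⟩, hq⟩
  have hn' : (n : ℚ) ≠ 0 := by exact_mod_cast hn
  have hq' : (m : ℚ) / n = m₀ / n₀ := hq
  rw [div_eq_div_iff hn' hn₀'] at hq'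
  have hmn : m * n₀ = m₀ * n := by exact_mod_cast hq'
  have h1 := h _ hp
  have h2 := h _ hp₀
  simp only at h1 h2
  have h3 : k * (n ^ 4 - n₀ ^ 4) = 0 := by
    have e1 : n₀ ^ 4 * (m ^ 4 + b * m ^ 3 * n + c * m ^ 2 * n ^ 2 + d * m * n ^ 3 + e * n ^ 4) =
        (m * n₀) ^ 4 + b * (m * n₀) ^ 3 * (n * n₀) + c * (m * n₀) ^ 2 * (n * n₀) ^ 2 +
          d * (m * n₀) * (n * n₀) ^ 3 + e * (n * n₀) ^ 4 := by ring
    have e2 : n ^ 4 * (m₀ ^ 4 + b * m₀ ^ 3 * n₀ + c * m₀ ^ 2 * n₀ ^ 2 + d * m₀ * n₀ ^ 3 +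
        e * n₀ ^ 4) =
        (m₀ * n) ^ 4 + b * (m₀ * n) ^ 3 * (n * n₀) + c * (m₀ * n) ^ 2 * (n * n₀) ^ 2 +
          d * (m₀ * n) * (n * n₀) ^ 3 + e * (n * n₀) ^ 4 := by ring
    rw [h1, hmn] at e1
    rw [h2] at e2
    linarith
  have h4 : n ^ 4 = n₀ ^ 4 := by
    have := (mul_eq_zero.1 h3).resolve_left hk
    linarith
  have hn4 : |n| = |n₀| := by
    have : |n| ^ 4 = |n₀| ^ 4 := by rw [← abs_pow, ← abs_pow, h4]
    exact (pow_left_inj₀ (abs_nonneg _) (abs_nonneg _) (by norm_num)).1 this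
  have hm4 : |m| = |m₀| := by
    have := congrArg abs hmn
    rw [abs_mul, abs_mul, hn4] at this
    exact mul_right_cancel₀ (abs_ne_zero.2 hn₀) this
  exact ⟨abs_le.1 hm4.le, abs_le.1 hn4.le⟩

theorem exists_root_infinite_rat_abs_sub_le {G : ℝ[X]} (hG : 0 < G.degree) (hsep : G.Separable)
    {κ : ℝ} {T : Set ℚ} (hT : T.Infinite)
    (hTG : ∀ x ∈ T, |G.eval (x : ℝ)| ≤ κ / x.den ^ 4) :
    ∃ α C : ℝ, G.eval α = 0 ∧ {x : ℚ | |α - x| ≤ C / x.den ^ 4}.Infinite := by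
  have hden : ∀ x : ℚ, (1 : ℝ) ≤ x.den := fun x => by exact_mod_cast x.pos
  have hκ : 0 ≤ κ := by
    obtain ⟨x, hx⟩ := hT.nonempty
    have h1 := (abs_nonneg _).trans (hTG x hx)
    have h2 : (0 : ℝ) < (x.den : ℝ) ^ 4 := by have := hden x; positivity
    by_contra! h0
    exact absurd h1 (not_le.2 (div_neg_of_neg_of_pos h0 h2))
  have htend := G.tendsto_norm_atTop hG (tendsto_norm_cocompact_atTop (E := ℝ))
  obtain ⟨K, hK, hKsub⟩ := Filter.mem_cocompact.1 (htend.eventually_gt_atTop κ)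
  set s : Set ℝ := (Rat.cast : ℚ → ℝ) '' T with hs
  have hsinf : s.Infinite := hT.image Rat.cast_injective.injOn
  have hsK : s ⊆ K := by
    rintro _ ⟨x, hx, rfl⟩
    by_contra hxK
    have h1 : κ < ‖G.eval (x : ℝ)‖ := hKsub hxK
    rw [Real.norm_eq_abs] at h1
    have h2 := hTG x hx
    have h3 : κ / (x.den : ℝ) ^ 4 ≤ κ := div_le_self hκ (one_le_pow₀ (hden x))
    linarith
  obtain ⟨α, -, hacc⟩ := hsinf.exists_accPt_of_subset_isCompact hK hsK
  have hnear : ∀ U ∈ nhds α, {x : ℚ | x ∈ T ∧ (x : ℝ) ∈ U}.Infinite := by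
    intro U hU
    have h1 : (U ∩ s).Infinite := Set.Infinite.of_accPt (hacc.nhds_inter hU)
    refine fun hfin => h1 ((hfin.image (Rat.cast : ℚ → ℝ)).subset ?_)
    rintro _ ⟨hxU, x, hx, rfl⟩
    exact ⟨x, ⟨hx, hxU⟩, rfl⟩
  have hroot : G.eval α = 0 := by
    by_contra hne
    have hpos : 0 < |G.eval α| := abs_pos.2 hne
    have hU : {y : ℝ | |G.eval α| / 2 < |G.eval y| ∧ |α - y| < 1} ∈ nhds α := by
      apply Filter.inter_mem
      · exact (G.continuous.abs.continuousAt (x := α)).eventually (lt_mem_nhds (by linarith))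
      · have : ContinuousAt (fun y : ℝ => |α - y|) α := by fun_prop
        exact this.eventually (gt_mem_nhds (by simp))
    obtain ⟨N, hN⟩ := exists_nat_gt (κ / (|G.eval α| / 2))
    refine hnear _ hU ((finite_rat_abs_sub_le_den_lt α 1 (N + 1)).subset ?_)
    rintro x ⟨hxT, hx1, hx2⟩
    refine ⟨hx2.le, ?_⟩
    by_contra! hlt
    have h1 := hTG x hxT
    have h2 : (N : ℝ) ≤ (x.den : ℝ) ^ 4 := by
      have : (N : ℝ) ≤ x.den := by exact_mod_cast (by omega : N ≤ x.den)
      exact this.trans (le_self_pow₀ (hden x) (by norm_num))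
    have h3 : κ / (x.den : ℝ) ^ 4 < |G.eval α| / 2 := by
      rw [div_lt_iff₀ (by linarith)] at hN
      rw [div_lt_iff₀ (by have := hden x; positivity)]
      nlinarith
    linarith
  obtain ⟨u, hu⟩ := dvd_iff_isRoot.2 hroot
  have hα : u.eval α ≠ 0 := by
    intro h0
    rw [hu] at hsep
    obtain ⟨A, B, hAB⟩ := hsep.isCoprime
    have := congrArg (eval α) hAB
    simp [h0] at this
  have hpos : 0 < |u.eval α| := abs_pos.2 hα
  have hU : {y : ℝ | |u.eval α| / 2 < |u.eval y|} ∈ nhds α :=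
    (u.continuous.abs.continuousAt (x := α)).eventually (lt_mem_nhds (by linarith))
  refine ⟨α, κ / (|u.eval α| / 2), hroot, (hnear _ hU).mono ?_⟩
  rintro x ⟨hxT, hx⟩
  have h1 := hTG x hxT
  have hx' : |u.eval α| / 2 < |u.eval (x : ℝ)| := hx
  rw [hu, eval_mul, eval_sub, eval_X, eval_C, abs_mul, abs_sub_comm] at h1
  change |α - x| ≤ _
  rw [div_right_comm, le_div_iff₀ (by linarith)]
  exact (mul_le_mul_of_nonneg_left hx'.le (abs_nonneg _)).trans h1

theorem finite_solutions_of_irreducible {b c d e k : ℤ} (hk : k ≠ 0)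
    (hirr : Irreducible (X ^ 4 + C b * X ^ 3 + C c * X ^ 2 + C d * X + C e : ℤ[X])) :
    {p : ℤ × ℤ | p.1 ^ 4 + b * p.1 ^ 3 * p.2 + c * p.1 ^ 2 * p.2 ^ 2 + d * p.1 * p.2 ^ 3 +
      e * p.2 ^ 4 = k}.Finite := by
  by_contra hinf
  set g : ℤ[X] := X ^ 4 + C b * X ^ 3 + C c * X ^ 2 + C d * X + C e with hg
  have hmonic : g.Monic := by rw [hg]; monicity!
  have hdeg : g.natDegree = 4 := by rw [hg]; compute_degree!
  have hmonicQ : (g.map (algebraMap ℤ ℚ)).Monic := hmonic.map _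
  have hirrQ : Irreducible (g.map (algebraMap ℤ ℚ)) :=
    (hmonic.irreducible_iff_irreducible_map_fraction_map (K := ℚ)).1 hirr
  have hmapmap : g.map (algebraMap ℤ ℝ) = (g.map (algebraMap ℤ ℚ)).map (algebraMap ℚ ℝ) := by
    rw [Polynomial.map_map]
    congr 1
  have hdegR : (g.map (algebraMap ℤ ℝ)).natDegree = 4 := by rw [hmonic.natDegree_map, hdeg]
  have heval : ∀ y : ℝ, (g.map (algebraMap ℤ ℝ)).eval y =
      y ^ 4 + b * y ^ 3 + c * y ^ 2 + d * y + e := fun y => by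
    simp [hg]
  obtain ⟨α, κ, hroot, happrox⟩ := exists_root_infinite_rat_abs_sub_le
    (G := g.map (algebraMap ℤ ℝ)) (κ := |(k : ℝ)|)
    (natDegree_pos_iff_degree_pos.1 (by omega)) (by rw [hmapmap]; exact hirrQ.separable.map)
    (infinite_image_div hinf hk fun p hp => hp) (by
      rintro _ ⟨⟨m, n⟩, ⟨hp, hn⟩, rfl⟩
      have hp' : m ^ 4 + b * m ^ 3 * n + c * m ^ 2 * n ^ 2 + d * m * n ^ 3 + e * n ^ 4 = k := hp
      have hpR : (m : ℝ) ^ 4 + b * m ^ 3 * n + c * m ^ 2 * n ^ 2 + d * m * n ^ 3 + e * n ^ 4 = k := by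
        exact_mod_cast hp'
      have hn' : (n : ℝ) ≠ 0 := by exact_mod_cast hn
      have hdvd : ((((m : ℚ) / n).den : ℕ) : ℤ) ∣ n := by
        rw [← Rat.divInt_eq_div]
        exact Rat.den_dvd m n
      have hle : ((((m : ℚ) / n).den : ℕ) : ℝ) ≤ |(n : ℝ)| := by
        have := Int.le_of_dvd (abs_pos.2 hn) ((dvd_abs _ _).2 hdvd)
        exact_mod_cast this
      rw [heval]
      have hval : ((((m : ℚ) / n : ℚ) : ℝ)) ^ 4 + b * (((m : ℚ) / n : ℚ) : ℝ) ^ 3 +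
          c * (((m : ℚ) / n : ℚ) : ℝ) ^ 2 + d * (((m : ℚ) / n : ℚ) : ℝ) + e = k / n ^ 4 := by
        push_cast
        rw [← hpR]
        field_simp
      have hpos : (0 : ℝ) < (((m : ℚ) / n).den : ℕ) := by exact_mod_cast Rat.pos _
      simp only [hval, abs_div, abs_pow]
      gcongr)
  rw [hmapmap, eval_map_algebraMap] at hroot
  have hmin : g.map (algebraMap ℤ ℚ) = minpoly ℚ α :=
    minpoly.eq_of_irreducible_of_monic hirrQ hroot hmonicQ
  have hmindeg : (minpoly ℚ α).natDegree = 4 := by rw [← hmin, hmonic.natDegree_map, hdeg]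
  have hα_int : IsIntegral ℚ α := ⟨_, hmonicQ, by rwa [← aeval_def]⟩
  refine happrox (finite_rat_abs_sub_le_div_den_pow_four (s := ![-e, -d, -c, -b]) ?_ hα_int ?_
    hmindeg κ)
  · rw [← eval_map_algebraMap, ← hmapmap, heval] at hroot
    simp only [Fin.sum_univ_four]
    simp
    linarith
  · rintro ⟨q, rfl⟩
    have := minpoly.eq_X_sub_C ℝ q
    rw [eq_ratCast] at this
    rw [this, natDegree_X_sub_C] at hmindeg
    omega

theorem infinite_ratio_eq_of_mul_eq {S : Set (ℤ × ℤ)} (hS : S.Infinite) {b c d e k : ℤ}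
    (hk : k ≠ 0) {φ ψ : ℤ × ℤ → ℤ}
    (hform : ∀ p : ℤ × ℤ, φ p * ψ p = p.1 ^ 4 + b * p.1 ^ 3 * p.2 + c * p.1 ^ 2 * p.2 ^ 2 +
      d * p.1 * p.2 ^ 3 + e * p.2 ^ 4)
    (h : ∀ p ∈ S, p.1 ^ 4 + b * p.1 ^ 3 * p.2 + c * p.1 ^ 2 * p.2 ^ 2 + d * p.1 * p.2 ^ 3 +
      e * p.2 ^ 4 = k) :
    ∃ s t : ℤ, s ≠ 0 ∧ t ≠ 0 ∧ ((fun p : ℤ × ℤ => (p.1 : ℚ) / p.2) ''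
      {p | φ p = s ∧ ψ p = t ∧ p.2 ≠ 0}).Infinite := by
  obtain ⟨s, ⟨t, ht⟩, hinf⟩ := infinite_fiber_of_dvd hS hk (φ := φ) fun p hp =>
    ⟨ψ p, by rw [hform, h p hp]⟩
  have hs0 : s ≠ 0 := by rintro rfl; simp at ht; exact hk ht
  have ht0 : t ≠ 0 := by rintro rfl; simp at ht; exact hk ht
  refine ⟨s, t, hs0, ht0, (infinite_image_div hinf hk fun p hp => h p hp.1).mono
    (Set.image_mono ?_)⟩
  rintro p ⟨⟨hpS, hps⟩, hpn⟩
  have hps' : φ p = s := hps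
  refine ⟨hps', mul_left_cancel₀ hs0 ?_, hpn⟩
  rw [← ht, ← h p hpS, ← hform, hps']

theorem eq_cube_of_infinite {q r s t b c d e k : ℤ} (hk : k ≠ 0)
    (hform : ∀ m n : ℤ, (m + q * n) * (m ^ 3 + r * m ^ 2 * n + s * m * n ^ 2 + t * n ^ 3) =
      m ^ 4 + b * m ^ 3 * n + c * m ^ 2 * n ^ 2 + d * m * n ^ 3 + e * n ^ 4)
    (hinf : {p : ℤ × ℤ | p.1 ^ 4 + b * p.1 ^ 3 * p.2 + c * p.1 ^ 2 * p.2 ^ 2 +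
      d * p.1 * p.2 ^ 3 + e * p.2 ^ 4 = k}.Infinite) :
    r = 3 * q ∧ s = 3 * q ^ 2 ∧ t = q ^ 3 := by
  obtain ⟨y, z, hy, hz, hyz⟩ := infinite_ratio_eq_of_mul_eq hinf hk
    (φ := fun p => p.1 + q * p.2)
    (ψ := fun p => p.1 ^ 3 + r * p.1 ^ 2 * p.2 + s * p.1 * p.2 ^ 2 + t * p.2 ^ 3)
    (fun p => hform p.1 p.2) (fun p hp => hp)
  obtain ⟨h3, h2, h1, h0⟩ := coeffs_eq_zero_of_infinite_roots (a := z - y ^ 3)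
    (b := 3 * z * q - y ^ 3 * r) (c := 3 * z * q ^ 2 - y ^ 3 * s) (d := z * q ^ 3 - y ^ 3 * t)
    (hyz.mono (by
      rintro _ ⟨⟨m, n⟩, ⟨hφ, hψ, hn⟩, rfl⟩
      have hn' : (n : ℚ) ≠ 0 := by exact_mod_cast hn
      have hφ' : (y : ℚ) = m + q * n := by exact_mod_cast hφ.symm
      have hψ' : (z : ℚ) = m ^ 3 + r * m ^ 2 * n + s * m * n ^ 2 + t * n ^ 3 := by
        exact_mod_cast hψ.symm
      simp only [Set.mem_ofPred_eq]
      rw [hφ', hψ']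
      field_simp
      ring))
  have h3' : z = y ^ 3 := by exact_mod_cast sub_eq_zero.1 h3
  have h2' : 3 * z * q = y ^ 3 * r := by exact_mod_cast sub_eq_zero.1 h2
  have h1' : 3 * z * q ^ 2 = y ^ 3 * s := by exact_mod_cast sub_eq_zero.1 h1
  have h0' : z * q ^ 3 = y ^ 3 * t := by exact_mod_cast sub_eq_zero.1 h0
  rw [← h3'] at h2' h1' h0'
  refine ⟨mul_left_cancel₀ hz ?_, mul_left_cancel₀ hz ?_, mul_left_cancel₀ hz ?_⟩ <;> linarith

theorem eq_of_infinite {q r s t b c d e k : ℤ} (hk : k ≠ 0)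
    (hform : ∀ m n : ℤ, (m ^ 2 + s * m * n + t * n ^ 2) * (m ^ 2 + q * m * n + r * n ^ 2) =
      m ^ 4 + b * m ^ 3 * n + c * m ^ 2 * n ^ 2 + d * m * n ^ 3 + e * n ^ 4)
    (hinf : {p : ℤ × ℤ | p.1 ^ 4 + b * p.1 ^ 3 * p.2 + c * p.1 ^ 2 * p.2 ^ 2 +
      d * p.1 * p.2 ^ 3 + e * p.2 ^ 4 = k}.Infinite) :
    q = s ∧ r = t := by
  obtain ⟨y, z, hy, hz, hyz⟩ := infinite_ratio_eq_of_mul_eq hinf hk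
    (φ := fun p => p.1 ^ 2 + s * p.1 * p.2 + t * p.2 ^ 2)
    (ψ := fun p => p.1 ^ 2 + q * p.1 * p.2 + r * p.2 ^ 2)
    (fun p => hform p.1 p.2) (fun p hp => hp)
  obtain ⟨-, h2, h1, h0⟩ := coeffs_eq_zero_of_infinite_roots (a := 0)
    (b := z - y) (c := z * s - y * q) (d := z * t - y * r)
    (hyz.mono (by
      rintro _ ⟨⟨m, n⟩, ⟨hφ, hψ, hn⟩, rfl⟩
      have hn' : (n : ℚ) ≠ 0 := by exact_mod_cast hn
      have hφ' : (y : ℚ) = m ^ 2 + s * m * n + t * n ^ 2 := by exact_mod_cast hφ.symm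
      have hψ' : (z : ℚ) = m ^ 2 + q * m * n + r * n ^ 2 := by exact_mod_cast hψ.symm
      simp only [Set.mem_ofPred_eq]
      rw [hφ', hψ']
      field_simp
      ring))
  have h2' : z = y := by exact_mod_cast sub_eq_zero.1 h2
  have h1' : z * s = y * q := by exact_mod_cast sub_eq_zero.1 h1
  have h0' : z * t = y * r := by exact_mod_cast sub_eq_zero.1 h0
  rw [← h2'] at h1' h0'
  exact ⟨(mul_left_cancel₀ hz h1').symm, (mul_left_cancel₀ hz h0').symm⟩

theorem monic_quartic_eq_sq_of_infinite {b c d e k : ℤ} (hk : k ≠ 0)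
    (hinf : {p : ℤ × ℤ | p.1 ^ 4 + b * p.1 ^ 3 * p.2 + c * p.1 ^ 2 * p.2 ^ 2 +
      d * p.1 * p.2 ^ 3 + e * p.2 ^ 4 = k}.Infinite) :
    ∃ v w : ℤ, b = 2 * v ∧ c = v ^ 2 + 2 * w ∧ d = 2 * v * w ∧ e = w ^ 2 := by
  have hred : ¬ Irreducible (X ^ 4 + C b * X ^ 3 + C c * X ^ 2 + C d * X + C e : ℤ[X]) :=
    fun h => hinf (finite_solutions_of_irreducible hk h)
  set g : ℤ[X] := X ^ 4 + C b * X ^ 3 + C c * X ^ 2 + C d * X + C e with hg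
  have hmonic : g.Monic := by rw [hg]; monicity!
  have hdeg : g.natDegree = 4 := by rw [hg]; compute_degree!
  have hne1 : g ≠ 1 := fun h => by rw [h] at hdeg; simp at hdeg
  rw [hmonic.irreducible_iff_natDegree', not_and] at hred
  have hred' := hred hne1
  push Not at hred'
  obtain ⟨F, G, hF, hG, hFG, hGdeg⟩ := hred'
  have hdegadd : F.natDegree + G.natDegree = 4 := by rw [← hF.natDegree_mul hG, hFG, hdeg]
  rw [hdeg, Finset.mem_Ioc] at hGdeg
  have hcoeff : ∀ i, (F * G).coeff i = g.coeff i := fun i => by rw [hFG]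
  have c0 := hcoeff 0
  have c1 := hcoeff 1
  have c2 := hcoeff 2
  have c3 := hcoeff 3
  simp only [hg, coeff_add, coeff_X_pow, coeff_X, coeff_C, coeff_mul,
    Finset.Nat.sum_antidiagonal_eq_sum_range_succ_mk, Finset.sum_range_succ,
    Finset.sum_range_zero] at c0 c1 c2 c3
  norm_num at c0 c1 c2 c3
  obtain hG1 | hG2 : G.natDegree = 1 ∨ G.natDegree = 2 := by omega
  · have hF3 : F.coeff 3 = 1 := by
      simpa [show F.natDegree = 3 by omega] using hF.coeff_natDegree
    have hG1' : G.coeff 1 = 1 := by simpa [hG1] using hG.coeff_natDegree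
    have hG2' : G.coeff 2 = 0 := coeff_eq_zero_of_natDegree_lt (by omega)
    have hG3' : G.coeff 3 = 0 := coeff_eq_zero_of_natDegree_lt (by omega)
    rw [hG1'] at c1
    rw [hG1', hG2'] at c2
    rw [hG1', hG2', hG3', hF3] at c3
    obtain ⟨h2, h1, h0⟩ := eq_cube_of_infinite (q := G.coeff 0) (r := F.coeff 2)
      (s := F.coeff 1) (t := F.coeff 0) hk
      (fun m n => by rw [← c0, ← c1, ← c2, ← c3]; ring) hinf
    rw [h0] at c0 c1
    rw [h1] at c1 c2
    rw [h2] at c2 c3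
    refine ⟨2 * G.coeff 0, G.coeff 0 ^ 2, ?_, ?_, ?_, ?_⟩ <;> linarith
  · have hF2 : F.coeff 2 = 1 := by
      simpa [show F.natDegree = 2 by omega] using hF.coeff_natDegree
    have hG2' : G.coeff 2 = 1 := by simpa [hG2] using hG.coeff_natDegree
    have hF3 : F.coeff 3 = 0 := coeff_eq_zero_of_natDegree_lt (by omega)
    have hG3 : G.coeff 3 = 0 := coeff_eq_zero_of_natDegree_lt (by omega)
    rw [hF2, hG2'] at c2
    rw [hF2, hG2', hF3, hG3] at c3
    obtain ⟨h1, h0⟩ := eq_of_infinite (q := G.coeff 1) (r := G.coeff 0)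
      (s := F.coeff 1) (t := F.coeff 0) hk
      (fun m n => by rw [← c0, ← c1, ← c2, ← c3]; ring) hinf
    rw [h0] at c0 c1 c2
    rw [h1] at c1 c2 c3
    refine ⟨F.coeff 1, F.coeff 0, ?_, ?_, ?_, ?_⟩ <;> linarith

theorem coeffs_eq_zero_of_infinite_of_leading_eq_zero {b c d e k : ℤ} (hk : k ≠ 0)
    (hinf : {p : ℤ × ℤ | b * p.1 ^ 3 * p.2 + c * p.1 ^ 2 * p.2 ^ 2 +
      d * p.1 * p.2 ^ 3 + e * p.2 ^ 4 = k}.Infinite) : b = 0 ∧ c = 0 ∧ d = 0 := by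
  obtain ⟨s, hsk, hs⟩ := infinite_fiber_of_dvd hinf hk (φ := Prod.snd) fun p hp =>
    ⟨b * p.1 ^ 3 + c * p.1 ^ 2 * p.2 + d * p.1 * p.2 ^ 2 + e * p.2 ^ 3, by
      rw [← show _ = k from hp]; ring⟩
  have hs0 : s ≠ 0 := by rintro rfl; exact hk (zero_dvd_iff.1 hsk)
  have hroots := hs.image (f := fun p : ℤ × ℤ => (p.1 : ℚ)) (by
    rintro ⟨m, n⟩ ⟨-, hn⟩ ⟨m', n'⟩ ⟨-, hn'⟩ hm
    simp only [Set.mem_preimage, Set.mem_singleton_iff] at hn hn'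
    simp only [Int.cast_inj] at hm
    rw [hm, hn, hn'])
  obtain ⟨h3, h2, h1, -⟩ := coeffs_eq_zero_of_infinite_roots (a := b * s)
    (b := c * s ^ 2) (c := d * s ^ 3) (d := e * s ^ 4 - k) (hroots.mono (by
      rintro _ ⟨⟨m, n⟩, ⟨hp, rfl⟩, rfl⟩
      have hp' : b * m ^ 3 * n + c * m ^ 2 * n ^ 2 + d * m * n ^ 3 + e * n ^ 4 = k := hp
      simp only [Set.mem_ofPred_eq]
      rw [← hp']
      push_cast
      ring))
  norm_cast at h3 h2 h1
  exact ⟨(mul_eq_zero.1 h3).resolve_right hs0,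
    (mul_eq_zero.1 h2).resolve_right (pow_ne_zero _ hs0),
    (mul_eq_zero.1 h1).resolve_right (pow_ne_zero _ hs0)⟩

theorem exists_eq_mul_sq_of_cube_mul_eq_sq {a b c d e v w : ℤ} (ha : a ≠ 0) (hb : b = 2 * v)
    (hc : a * c = v ^ 2 + 2 * w) (hd : a ^ 2 * d = 2 * v * w) (he : a ^ 3 * e = w ^ 2) :
    ∃ c' u v w : ℤ, ∀ m n : ℤ,
      a * m ^ 4 + b * m ^ 3 * n + c * m ^ 2 * n ^ 2 + d * m * n ^ 3 + e * n ^ 4 =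
        c' * (u * m ^ 2 + v * m * n + w * n ^ 2) ^ 2 := by
  set g : ℤ[X] := C a * X ^ 4 + C b * X ^ 3 + C c * X ^ 2 + C d * X + C e with hg
  set q : ℤ[X] := C (a ^ 2) * X ^ 2 + C (v * a) * X + C w with hq
  have hgq : C (a ^ 3) * g = q * q := by
    have hc' : (C a * C c : ℤ[X]) = C v ^ 2 + 2 * C w := by
      rw [← C_mul, hc]; simp only [C_add, C_mul, C_pow, C_ofNat]
    have hd' : (C a ^ 2 * C d : ℤ[X]) = 2 * C v * C w := by
      rw [← C_pow, ← C_mul, hd]; simp only [C_mul, C_ofNat]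
    have he' : (C a ^ 3 * C e : ℤ[X]) = C w ^ 2 := by
      rw [← C_pow, ← C_mul, he]; simp only [C_pow]
    simp only [hg, hq, hb, C_mul, C_pow, C_ofNat]
    linear_combination C a ^ 2 * X ^ 2 * hc' + C a * X * hd' + he'
  have hdvd : a ^ 3 ∣ q.content * q.content := by
    rw [← content_mul, ← hgq, content_C_mul]
    exact (dvd_normalize_iff.2 dvd_rfl).mul_right _
  obtain ⟨c', hc'⟩ := hdvd
  obtain ⟨U, hU⟩ : q.content ∣ a ^ 2 := by
    simpa only [hq, coeff_add, coeff_C_mul, coeff_X_pow, coeff_X, coeff_C, if_true, mul_one,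
      OfNat.ofNat_ne_zero, OfNat.one_ne_ofNat, if_false, mul_zero, add_zero]
      using content_dvd_coeff (p := q) 2
  obtain ⟨V, hV⟩ : q.content ∣ v * a := by
    simpa only [hq, coeff_add, coeff_C_mul, coeff_X_pow, coeff_X, coeff_C, if_true, mul_one,
      OfNat.one_ne_ofNat, one_ne_zero, if_false, mul_zero, add_zero, zero_add]
      using content_dvd_coeff (p := q) 1
  obtain ⟨W, hW⟩ : q.content ∣ w := by
    simpa only [hq, coeff_add, coeff_C_mul, coeff_X_pow, coeff_X, coeff_C, if_true, mul_one,
      OfNat.zero_ne_ofNat, one_ne_zero, if_false, mul_zero, add_zero, zero_add]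
      using content_dvd_coeff (p := q) 0
  refine ⟨c', U, V, W, fun m n => mul_left_cancel₀ (pow_ne_zero 3 ha) ?_⟩
  calc a ^ 3 * (a * m ^ 4 + b * m ^ 3 * n + c * m ^ 2 * n ^ 2 + d * m * n ^ 3 + e * n ^ 4)
      = (a ^ 2 * m ^ 2 + v * a * m * n + w * n ^ 2) ^ 2 := by
        rw [hb]
        linear_combination a ^ 2 * m ^ 2 * n ^ 2 * hc + a * m * n ^ 3 * hd + n ^ 4 * he
    _ = q.content * q.content * (U * m ^ 2 + V * m * n + W * n ^ 2) ^ 2 := by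
        have h : a ^ 2 * m ^ 2 + v * a * m * n + w * n ^ 2 =
            q.content * (U * m ^ 2 + V * m * n + W * n ^ 2) := by
          linear_combination m ^ 2 * hU + m * n * hV + n ^ 2 * hW
        rw [h]
        ring
    _ = a ^ 3 * (c' * (U * m ^ 2 + V * m * n + W * n ^ 2) ^ 2) := by rw [hc']; ring

theorem quartic_infinite_solutions_square (a b c d e k : ℤ) (hk : k ≠ 0)
    (hinf : {p : ℤ × ℤ | a * p.1 ^ 4 + b * p.1 ^ 3 * p.2 + c * p.1 ^ 2 * p.2 ^ 2 +
      d * p.1 * p.2 ^ 3 + e * p.2 ^ 4 = k}.Infinite) :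
    ∃ c' u v w : ℤ, ∀ m n : ℤ,
      a * m ^ 4 + b * m ^ 3 * n + c * m ^ 2 * n ^ 2 + d * m * n ^ 3 + e * n ^ 4 =
        c' * (u * m ^ 2 + v * m * n + w * n ^ 2) ^ 2 := by
  obtain rfl | ha := eq_or_ne a 0
  · simp only [zero_mul, zero_add] at hinf
    obtain ⟨rfl, rfl, rfl⟩ := coeffs_eq_zero_of_infinite_of_leading_eq_zero hk hinf
    exact ⟨e, 0, 0, 1, fun m n => by ring⟩
  have himage := hinf.image (f := fun p : ℤ × ℤ => (a * p.1, p.2)) (by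
    rintro ⟨m, n⟩ - ⟨m', n'⟩ - h
    simpa [ha] using h)
  obtain ⟨v, w, hb, hc, hd, he⟩ := monic_quartic_eq_sq_of_infinite (b := b) (c := a * c)
    (d := a ^ 2 * d) (e := a ^ 3 * e) (mul_ne_zero (pow_ne_zero 3 ha) hk) (himage.mono (by
      rintro _ ⟨⟨m, n⟩, hp, rfl⟩
      simp only [Set.mem_ofPred_eq] at hp ⊢
      rw [← hp]
      ring))
  exact exists_eq_mul_sq_of_cube_mul_eq_sq ha hb hc hd he
end

section
/- Let A, B, C be nonzero integers and let (x_0, y_0, z_0) be integers with z_0 ≠ 0 satisfying A*x_0^2 + B*y_0^2 + C*z_0^2 = 0. Then for every integer solution (x,y,z) of A*x^2 + B*y^2 + C*z^2 = 0 there exist coprime integers m, n and coprime integers p, q with q > 0 dividing 2*lcm(A,B)*C*z_0^2, such that q*x = p*(x_0*A*m^2 + 2*y_0*B*m*n - x_0*B*n^2), q*y = p*(-y_0*A*m^2 + 2*x_0*A*m*n + y_0*B*n^2), and q*z = p*(z_0*A*m^2 + z_0*B*n^2). -/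
theorem Int.exists_isCoprime_factorization {a b : ℤ} (h : a ≠ 0 ∨ b ≠ 0) :
    ∃ d m n : ℤ, 0 < d ∧ IsCoprime m n ∧ a = d * m ∧ b = d * n := by
  have hd : 0 < Int.gcd a b := Int.gcd_pos_iff.2 h
  obtain ⟨m, n, hmn, ha, hb⟩ := Int.exists_gcd_one hd
  exact ⟨Int.gcd a b, m, n, by exact_mod_cast hd, Int.isCoprime_iff_gcd_eq_one.2 hmn,
    by rwa [mul_comm], by rwa [mul_comm]⟩

/-- A common divisor of the values of the parametrizing forms at a coprime pair divides
`2 * lcm A B * C * z₀ ^ 2`. -/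
theorem dvd_of_dvd_conic_parametrization {A B C x₀ y₀ z₀ m n q : ℤ}
    (h₀ : A * x₀ ^ 2 + B * y₀ ^ 2 + C * z₀ ^ 2 = 0) (hmn : IsCoprime m n)
    (hx : q ∣ x₀ * A * m ^ 2 + 2 * y₀ * B * m * n - x₀ * B * n ^ 2)
    (hy : q ∣ -y₀ * A * m ^ 2 + 2 * x₀ * A * m * n + y₀ * B * n ^ 2)
    (hz : q ∣ z₀ * A * m ^ 2 + z₀ * B * n ^ 2) :
    q ∣ 2 * lcm A B * C * z₀ ^ 2 := by
  obtain ⟨r, hr⟩ := hx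
  obtain ⟨s, hs⟩ := hy
  obtain ⟨t, ht⟩ := hz
  obtain ⟨a, ha⟩ := dvd_lcm_left A B
  obtain ⟨b, hb⟩ := dvd_lcm_right A B
  have hm : q ∣ 2 * lcm A B * C * z₀ ^ 2 * m ^ 2 :=
    ⟨a * (C * z₀ * t - A * x₀ * r + B * y₀ * s), by
      rw [ha]
      linear_combination a * (C * z₀ * ht - A * x₀ * hr + B * y₀ * hs)
        + a * (A * m ^ 2 - B * n ^ 2) * h₀⟩
  have hn : q ∣ 2 * lcm A B * C * z₀ ^ 2 * n ^ 2 :=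
    ⟨b * (C * z₀ * t + A * x₀ * r - B * y₀ * s), by
      rw [hb]
      linear_combination b * (C * z₀ * ht + A * x₀ * hr - B * y₀ * hs)
        - b * (A * m ^ 2 - B * n ^ 2) * h₀⟩
  obtain ⟨u, v, huv⟩ : IsCoprime (m ^ 2) (n ^ 2) := hmn.pow
  rw [← mul_one (2 * lcm A B * C * z₀ ^ 2), ← huv, mul_add, mul_left_comm, mul_left_comm _ v]
  exact dvd_add (hm.mul_left u) (hn.mul_left v)

/-- Every integer point of the conic is, up to scaling, in the image of the parametrization. -/
theorem exists_conic_parametrization {A B C x₀ y₀ z₀ : ℤ}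
    (hA : A ≠ 0) (hB : B ≠ 0) (hC : C ≠ 0) (hz₀ : z₀ ≠ 0)
    (h₀ : A * x₀ ^ 2 + B * y₀ ^ 2 + C * z₀ ^ 2 = 0)
    {x y z : ℤ} (h : A * x ^ 2 + B * y ^ 2 + C * z ^ 2 = 0) :
    ∃ m n k l : ℤ, (m ≠ 0 ∨ n ≠ 0) ∧ k ≠ 0 ∧
      k * x = l * (x₀ * A * m ^ 2 + 2 * y₀ * B * m * n - x₀ * B * n ^ 2) ∧
      k * y = l * (-y₀ * A * m ^ 2 + 2 * x₀ * A * m * n + y₀ * B * n ^ 2) ∧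
      k * z = l * (z₀ * A * m ^ 2 + z₀ * B * n ^ 2) := by
  by_cases hmn : z₀ * x + x₀ * z ≠ 0 ∨ z₀ * y + y₀ * z ≠ 0
  · obtain ⟨m, hm⟩ : ∃ m, m = z₀ * x + x₀ * z := ⟨_, rfl⟩
    obtain ⟨n, hn⟩ : ∃ n, n = z₀ * y + y₀ * z := ⟨_, rfl⟩
    obtain ⟨k, hk⟩ : ∃ k, k = 2 * z₀ ^ 2 * (A * x * x₀ + B * y * y₀ - C * z * z₀) := ⟨_, rfl⟩
    rw [← hm, ← hn] at hmn
    have hx : k * x = x₀ * A * m ^ 2 + 2 * y₀ * B * m * n - x₀ * B * n ^ 2 := by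
      rw [hk, hm, hn]
      linear_combination x₀ * z₀ ^ 2 * h - (2 * z₀ * z * x + x₀ * z ^ 2) * h₀
    have hy : k * y = -y₀ * A * m ^ 2 + 2 * x₀ * A * m * n + y₀ * B * n ^ 2 := by
      rw [hk, hm, hn]
      linear_combination y₀ * z₀ ^ 2 * h - (2 * z₀ * z * y + y₀ * z ^ 2) * h₀
    have hz : k * z = z₀ * A * m ^ 2 + z₀ * B * n ^ 2 := by
      rw [hk, hm, hn]
      linear_combination -z₀ ^ 3 * h - z₀ * z ^ 2 * h₀
    refine ⟨m, n, k, 1, hmn, ?_, by rw [one_mul, hx], by rw [one_mul, hy], by rw [one_mul, hz]⟩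
    intro hk0
    rw [hk0, zero_mul] at hx hy hz
    have hm0 : 2 * A * C * z₀ ^ 2 * m ^ 2 = 0 := by
      linear_combination -(C * z₀ * hz - A * x₀ * hx + B * y₀ * hy)
        + (A * m ^ 2 - B * n ^ 2) * h₀
    have hn0 : 2 * B * C * z₀ ^ 2 * n ^ 2 = 0 := by
      linear_combination -(C * z₀ * hz + A * x₀ * hx - B * y₀ * hy)
        - (A * m ^ 2 - B * n ^ 2) * h₀
    exact hmn.elim (· (by simpa [hA, hC, hz₀] using hm0)) (· (by simpa [hB, hC, hz₀] using hn0))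
  · push Not at hmn
    obtain ⟨hx, hy⟩ := hmn
    refine ⟨y₀ * B, -x₀ * A, -A * B * C * z₀ ^ 3, z, ?_, by simp [hA, hB, hC, hz₀], ?_, ?_, ?_⟩
    · by_contra! hne
      have hy0 : y₀ = 0 := by simpa [hB] using hne.1
      have hx0 : x₀ = 0 := by simpa [hA] using hne.2
      simp [hx0, hy0, hC, hz₀] at h₀
    · linear_combination -A * B * C * z₀ ^ 2 * hx + A * B * x₀ * z * h₀
    · linear_combination -A * B * C * z₀ ^ 2 * hy + A * B * y₀ * z * h₀
    · linear_combination -z * z₀ * A * B * h₀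

theorem general_solution_ternary_quadratic (A B C x₀ y₀ z₀ : ℤ)
    (hA : A ≠ 0) (hB : B ≠ 0) (hC : C ≠ 0) (hz₀ : z₀ ≠ 0)
    (h₀ : A * x₀ ^ 2 + B * y₀ ^ 2 + C * z₀ ^ 2 = 0)
    (x y z : ℤ) (h : A * x ^ 2 + B * y ^ 2 + C * z ^ 2 = 0) :
    ∃ m n p q : ℤ, IsCoprime m n ∧ IsCoprime p q ∧ 0 < q ∧
      q ∣ 2 * lcm A B * C * z₀ ^ 2 ∧
      q * x = p * (x₀ * A * m ^ 2 + 2 * y₀ * B * m * n - x₀ * B * n ^ 2) ∧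
      q * y = p * (-y₀ * A * m ^ 2 + 2 * x₀ * A * m * n + y₀ * B * n ^ 2) ∧
      q * z = p * (z₀ * A * m ^ 2 + z₀ * B * n ^ 2) := by
  obtain ⟨m', n', k, l, hmn', hk, hx, hy, hz⟩ := exists_conic_parametrization hA hB hC hz₀ h₀ h
  obtain ⟨d, m, n, -, hmn, rfl, rfl⟩ := Int.exists_isCoprime_factorization hmn'
  have hk2 : 0 < k ^ 2 := by positivity
  obtain ⟨e, p, q, he, hpq, hp, hq⟩ :=
    Int.exists_isCoprime_factorization (a := k * l * d ^ 2) (Or.inr hk2.ne')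
  have hq0 : 0 < q := pos_of_mul_pos_right (hq ▸ hk2) he.le
  have hx' : q * x = p * (x₀ * A * m ^ 2 + 2 * y₀ * B * m * n - x₀ * B * n ^ 2) := by
    apply mul_left_cancel₀ he.ne'
    rw [← mul_assoc, ← mul_assoc, ← hp, ← hq]
    linear_combination k * hx
  have hy' : q * y = p * (-y₀ * A * m ^ 2 + 2 * x₀ * A * m * n + y₀ * B * n ^ 2) := by
    apply mul_left_cancel₀ he.ne'
    rw [← mul_assoc, ← mul_assoc, ← hp, ← hq]
    linear_combination k * hy
  have hz' : q * z = p * (z₀ * A * m ^ 2 + z₀ * B * n ^ 2) := by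
    apply mul_left_cancel₀ he.ne'
    rw [← mul_assoc, ← mul_assoc, ← hp, ← hq]
    linear_combination k * hz
  exact ⟨m, n, p, q, hmn, hpq, hq0,
    dvd_of_dvd_conic_parametrization h₀ hmn
      (hpq.symm.dvd_of_dvd_mul_left ⟨x, hx'.symm⟩)
      (hpq.symm.dvd_of_dvd_mul_left ⟨y, hy'.symm⟩)
      (hpq.symm.dvd_of_dvd_mul_left ⟨z, hz'.symm⟩),
    hx', hy', hz'⟩
end
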